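/- Let m_N, k_N be sequences of natural numbers with p_N := m_N·k_N → ∞ and p_N = o(N). For each N let A_N be Haar-distributed on O(N) and set y_{i,j}^{(N)} = √N·(A_N)_{i,j} for 1 ≤ i ≤ m_N, 1 ≤ j ≤ k_N. Then for every bounded measurable function f : ℝ → ℝ, lim_{N→∞} (1/p_N)·log 𝔼[exp(∑_{i=1}^{m_N} ∑_{j=1}^{k_N} f(y_{i,j}^{(N)}))] = log ∫_ℝ e^{f(x)} dγ(x), where γ is the standard Gaussian measure on ℝ. -/

import Mathlib

open MeasureTheory ProbabilityTheory Filter Matrix Asymptotics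

noncomputable instance matrixMeasurableSpace {N : ℕ} :
    MeasurableSpace (Matrix (Fin N) (Fin N) ℝ) :=
  show MeasurableSpace (Fin N → Fin N → ℝ) from inferInstance

/-- The `(i,j)` entry of `A` (with `0`-based indices), or `0` if out of range. -/
def entryOrZero {N : ℕ} (A : Matrix (Fin N) (Fin N) ℝ) (i j : ℕ) : ℝ :=
  if h : i < N ∧ j < N then A ⟨i, h.1⟩ ⟨j, h.2⟩ else 0

open scoped ENNReal

/-- `μ` is a probability measure carried by the orthogonal group `O(N)` and invariant under left
multiplication by orthogonal matrices. -/
structure IsOrthogonalHaar {N : ℕ} (μ : Measure (Matrix (Fin N) (Fin N) ℝ)) : Prop where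
  prob : IsProbabilityMeasure μ
  supp : μ {A | A * Aᵀ = 1} = 1
  inv : ∀ B : Matrix (Fin N) (Fin N) ℝ, B * Bᵀ = 1 → μ.map (fun A => B * A) = μ

theorem measurable_matrix_entry {N : ℕ} (i j : Fin N) :
    Measurable fun A : Matrix (Fin N) (Fin N) ℝ => A i j :=
  (measurable_pi_apply j).comp (measurable_pi_apply (X := fun _ : Fin N => Fin N → ℝ) i)

theorem measurable_matrix_of_entries {N : ℕ} {α : Type*} [MeasurableSpace α]
    {F : α → Matrix (Fin N) (Fin N) ℝ} (h : ∀ i j, Measurable fun a => F a i j) : Measurable F :=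
  measurable_pi_iff.2 fun i => measurable_pi_iff.2 fun j => h i j

theorem Measurable.matrix_mul {N : ℕ} {α : Type*} [MeasurableSpace α]
    {F G : α → Matrix (Fin N) (Fin N) ℝ} (hF : Measurable F) (hG : Measurable G) :
    Measurable fun a => F a * G a := by
  refine measurable_matrix_of_entries fun i j => ?_
  simp only [Matrix.mul_apply]
  exact Finset.measurable_sum _ fun l _ =>
    ((measurable_matrix_entry i l).comp hF).mul ((measurable_matrix_entry l j).comp hG)

theorem Measurable.matrix_transpose {N : ℕ} {α : Type*} [MeasurableSpace α]
    {F : α → Matrix (Fin N) (Fin N) ℝ} (hF : Measurable F) : Measurable fun a => (F a)ᵀ :=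
  measurable_matrix_of_entries fun i j => (measurable_matrix_entry j i).comp hF

theorem measurableSet_orthogonal {N : ℕ} :
    MeasurableSet {A : Matrix (Fin N) (Fin N) ℝ | A * Aᵀ = 1} := by
  have : {A : Matrix (Fin N) (Fin N) ℝ | A * Aᵀ = 1}
      = ⋂ i, ⋂ j, {A | (A * Aᵀ) i j = (1 : Matrix (Fin N) (Fin N) ℝ) i j} := by
    ext A
    simp only [Set.mem_ofPred_eq, Set.mem_iInter]
    exact ⟨fun h i j => by rw [h], fun h => Matrix.ext h⟩
  rw [this]
  refine MeasurableSet.iInter fun i => MeasurableSet.iInter fun j => ?_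
  exact measurableSet_eq_fun
    ((measurable_matrix_entry i j).comp (measurable_id.matrix_mul measurable_id.matrix_transpose))
    measurable_const

namespace IsOrthogonalHaar

variable {N : ℕ} {μ : Measure (Matrix (Fin N) (Fin N) ℝ)}

theorem ae_orthogonal (hμ : IsOrthogonalHaar μ) : ∀ᵐ A ∂μ, A * Aᵀ = 1 :=
  have := hμ.prob
  (mem_ae_iff_prob_eq_one measurableSet_orthogonal).2 hμ.supp

theorem lintegral_mul_left (hμ : IsOrthogonalHaar μ) {B : Matrix (Fin N) (Fin N) ℝ}
    (hB : B * Bᵀ = 1) {φ : Matrix (Fin N) (Fin N) ℝ → ℝ≥0∞} (hφ : Measurable φ) :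
    ∫⁻ A, φ (B * A) ∂μ = ∫⁻ A, φ A ∂μ := by
  conv_rhs => rw [← hμ.inv B hB]
  rw [lintegral_map hφ (show Measurable fun A => B * A from
    Measurable.matrix_mul measurable_const measurable_id)]

theorem lintegral_transpose (hμ : IsOrthogonalHaar μ)
    {φ : Matrix (Fin N) (Fin N) ℝ → ℝ≥0∞} (hφ : Measurable φ) :
    ∫⁻ A, φ Aᵀ ∂μ = ∫⁻ A, φ A ∂μ := by
  have := hμ.prob
  have h1 : ∫⁻ B, ∫⁻ A, φ (Bᵀ * A) ∂μ ∂μ = ∫⁻ A, φ A ∂μ := by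
    rw [lintegral_congr_ae (g := fun _ => ∫⁻ A, φ A ∂μ), lintegral_const, measure_univ, mul_one]
    filter_upwards [hμ.ae_orthogonal] with B hB
    exact hμ.lintegral_mul_left (by rw [transpose_transpose]; exact mul_eq_one_comm.1 hB) hφ
  have h2 : ∫⁻ A, ∫⁻ B, φ (Bᵀ * A) ∂μ ∂μ = ∫⁻ A, φ Aᵀ ∂μ := by
    rw [lintegral_congr_ae (g := fun _ => ∫⁻ A, φ Aᵀ ∂μ), lintegral_const, measure_univ, mul_one]
    filter_upwards [hμ.ae_orthogonal] with A hA
    have := hμ.lintegral_mul_left (B := Aᵀ) (φ := fun X => φ Xᵀ)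
      (by rw [transpose_transpose]; exact mul_eq_one_comm.1 hA)
      (hφ.comp measurable_id.matrix_transpose)
    simpa only [transpose_mul, transpose_transpose] using this
  rw [← h1, ← h2]
  refine lintegral_lintegral_swap (Measurable.aemeasurable ?_)
  exact hφ.comp (measurable_snd.matrix_transpose.matrix_mul measurable_fst)

theorem lintegral_mul_right (hμ : IsOrthogonalHaar μ) {B : Matrix (Fin N) (Fin N) ℝ}
    (hB : B * Bᵀ = 1) {φ : Matrix (Fin N) (Fin N) ℝ → ℝ≥0∞} (hφ : Measurable φ) :
    ∫⁻ A, φ (A * B) ∂μ = ∫⁻ A, φ A ∂μ := by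
  rw [← hμ.lintegral_transpose (φ := fun A => φ (A * B))
      (hφ.comp (Measurable.matrix_mul measurable_id measurable_const)),
    ← hμ.lintegral_transpose hφ,
    ← hμ.lintegral_mul_left (B := Bᵀ) (by rw [transpose_transpose]; exact mul_eq_one_comm.1 hB)
      (φ := fun A => φ Aᵀ) (hφ.comp (Measurable.matrix_transpose measurable_id))]
  simp [transpose_mul]

end IsOrthogonalHaar

/-- Vectors with the orthonormality relations on rows of index `< m` extend to an orthogonal
matrix. -/
theorem exists_orthogonal_extension {N : ℕ} (s : Set (Fin N)) (v : Fin N → Fin N → ℝ)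
    (hv : ∀ i ∈ s, ∀ j ∈ s, v i ⬝ᵥ v j = if i = j then 1 else 0) :
    ∃ C : Matrix (Fin N) (Fin N) ℝ, C * Cᵀ = 1 ∧ ∀ i ∈ s, C i = v i := by
  obtain ⟨b, hb⟩ := Orthonormal.exists_orthonormalBasis_extension_of_card_eq (𝕜 := ℝ)
    (E := EuclideanSpace ℝ (Fin N)) (ι := Fin N) (by simp)
    (v := fun i => WithLp.toLp 2 (v i)) (s := s) (by
      classical
      rw [orthonormal_iff_ite]
      intro i j
      have := hv i i.2 j j.2
      simp only [Set.domRestrict_apply, EuclideanSpace.inner_eq_star_dotProduct]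
      rw [dotProduct_comm]
      simpa [Subtype.ext_iff] using this)
  refine ⟨Matrix.of fun i j => b i j, ?_, fun i hi => ?_⟩
  · ext i j
    have := orthonormal_iff_ite.1 b.orthonormal i j
    rw [Matrix.mul_apply, Matrix.one_apply, ← this, EuclideanSpace.inner_eq_star_dotProduct]
    simp [dotProduct, mul_comm]
  · ext j
    have := hb i hi
    simp [this]

/-- Integral of a radial function on a Euclidean space of dimension `r + 2`, in terms of the squared
radius. -/
theorem exists_lintegral_dotProduct_self (r : ℕ) :
    ∃ C : ℝ≥0∞, ∀ H : ℝ → ℝ≥0∞, Measurable H →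
      ∫⁻ x : Fin (r + 2) → ℝ, H (x ⬝ᵥ x)
        = C * ∫⁻ t in Set.Ioi (0 : ℝ), H t * ENNReal.ofReal (√t ^ r) := by
  let E := EuclideanSpace ℝ (Fin (r + 2))
  let ν : Measure E := volume
  have hdim : Module.finrank ℝ E = r + 2 := by simp [E]
  refine ⟨ν.toSphere Set.univ * ENNReal.ofReal (1 / 2), fun H hH => ?_⟩
  have h1 : ∫⁻ x : Fin (r + 2) → ℝ, H (x ⬝ᵥ x) = ∫⁻ x : E, H (‖x‖ ^ 2) := by
    rw [← (PiLp.volume_preserving_toLp (Fin (r + 2))).lintegral_comp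
      (f := fun x : E => H (‖x‖ ^ 2)) (by fun_prop)]
    refine lintegral_congr fun x => ?_
    rw [EuclideanSpace.real_norm_sq_eq]
    simp [dotProduct, sq]
  have h2 : ∫⁻ x : E, H (‖x‖ ^ 2)
      = ν.toSphere Set.univ * ∫⁻ ρ in Set.Ioi (0 : ℝ), ENNReal.ofReal (ρ ^ (r + 1)) * H (ρ ^ 2) := by
    calc
      ∫⁻ x : E, H (‖x‖ ^ 2) = ∫⁻ x : ({(0)}ᶜ : Set E), H (‖x.1‖ ^ 2) ∂(ν.comap (↑)) := by
        rw [lintegral_subtype_comap (measurableSet_singleton _).compl fun x : E => H (‖x‖ ^ 2),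
          restrict_compl_singleton]
      _ = ∫⁻ x, H ((x.2 : ℝ) ^ 2) ∂ν.toSphere.prod (.volumeIoiPow (Module.finrank ℝ E - 1)) := by
        rw [← (ν.measurePreserving_homeomorphUnitSphereProd).lintegral_comp_emb
          (Homeomorph.measurableEmbedding _)]
        simp
      _ = ν.toSphere Set.univ *
          ∫⁻ ρ : Set.Ioi (0 : ℝ), H ((ρ : ℝ) ^ 2) ∂.volumeIoiPow (Module.finrank ℝ E - 1) := by
        rw [lintegral_prod _ (by fun_prop)]
        simp [mul_comm]
      _ = _ := by
        congr 1
        rw [Measure.volumeIoiPow, lintegral_withDensity_eq_lintegral_mul _ (by fun_prop)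
          (by fun_prop), ← lintegral_subtype_comap measurableSet_Ioi, hdim]
        rfl
  have h3 : ∫⁻ ρ in Set.Ioi (0 : ℝ), ENNReal.ofReal (ρ ^ (r + 1)) * H (ρ ^ 2)
      = ENNReal.ofReal (1 / 2) * ∫⁻ t in Set.Ioi (0 : ℝ), H t * ENNReal.ofReal (√t ^ r) := by
    have him : Set.Ioi (0 : ℝ) = Real.sqrt '' Set.Ioi 0 := by
      ext y
      simp only [Set.mem_Ioi, Set.mem_image]
      exact ⟨fun hy => ⟨y ^ 2, by positivity, Real.sqrt_sq hy.le⟩, by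
        rintro ⟨t, ht, rfl⟩; positivity⟩
    conv_lhs => rw [him]
    rw [lintegral_image_eq_lintegral_abs_deriv_mul (f' := fun t => 1 / (2 * √t)) measurableSet_Ioi
      (fun t ht => (Real.hasDerivAt_sqrt (ne_of_gt ht)).hasDerivWithinAt)
      (fun x hx y hy h => (Real.sqrt_inj (le_of_lt hx) (le_of_lt hy)).1 h),
      ← lintegral_const_mul' _ _ ENNReal.ofReal_ne_top]
    refine setLIntegral_congr_fun measurableSet_Ioi fun t ht => ?_
    have ht' : 0 < √t := Real.sqrt_pos.2 ht
    rw [Real.sq_sqrt (le_of_lt ht), ← mul_assoc, ← ENNReal.ofReal_mul (abs_nonneg _), mul_comm (H t),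
      ← mul_assoc, ← ENNReal.ofReal_mul (by norm_num), abs_of_pos (by positivity)]
    congr 2
    field_simp
    ring
  rw [h1, h2, h3, mul_assoc]

theorem lintegral_Ioi_add_mul_sqrt_pow {r : ℕ} (hr : r ≠ 0) {a : ℝ} (ha : 0 ≤ a) (G : ℝ → ℝ≥0∞) :
    ∫⁻ t in Set.Ioi (0 : ℝ), G (a + t) * ENNReal.ofReal (√t ^ r)
      = ∫⁻ t in Set.Ioi (0 : ℝ), G t * ENNReal.ofReal (√(t - a) ^ r) := by
  have h1 : ∀ F : ℝ → ℝ≥0∞, (∀ t ≤ 0, F t = 0) → ∫⁻ t in Set.Ioi (0 : ℝ), F t = ∫⁻ t, F t := by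
    intro F hF
    refine setLIntegral_eq_of_support_subset ?_ 
    intro t ht
    by_contra h
    exact ht (hF t (not_lt.1 h))
  rw [h1, h1, ← lintegral_add_left_eq_self (fun t => G t * ENNReal.ofReal (√(t - a) ^ r)) a]
  · simp
  · intro t ht
    rw [Real.sqrt_eq_zero_of_nonpos (by linarith)]; simp [hr]
  · intro t ht
    rw [Real.sqrt_eq_zero_of_nonpos (by linarith)]; simp [hr]

theorem dotProduct_mulVec_self_of_orthogonal {N : ℕ} {A : Matrix (Fin N) (Fin N) ℝ}
    (hA : A * Aᵀ = 1) (x : Fin N → ℝ) : (A *ᵥ x) ⬝ᵥ (A *ᵥ x) = x ⬝ᵥ x := by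
  rw [dotProduct_mulVec, ← mulVec_transpose, mulVec_mulVec, mul_eq_one_comm.1 hA, one_mulVec]

theorem lintegral_mulVec_of_orthogonal {N : ℕ} {A : Matrix (Fin N) (Fin N) ℝ}
    (hA : A * Aᵀ = 1) {G : (Fin N → ℝ) → ℝ≥0∞} (hG : Measurable G) :
    ∫⁻ x, G (A *ᵥ x) = ∫⁻ x, G x := by
  have hdet : A.det * A.det = 1 := by
    have := congrArg Matrix.det hA
    rwa [det_mul, det_transpose, det_one] at this
  have h0 : A.det ≠ 0 := left_ne_zero_of_mul_eq_one hdet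
  have h1 : |A.det| = 1 := by
    have : |A.det| * |A.det| = 1 := by rw [← abs_mul, hdet, abs_one]
    nlinarith [abs_nonneg A.det]
  have h := Real.map_matrix_volume_pi_eq_smul_volume_pi h0
  rw [abs_inv, h1, inv_one, ENNReal.ofReal_one, one_smul] at h
  conv_rhs => rw [← h]
  rw [lintegral_map hG (LinearMap.continuous_of_finiteDimensional _).measurable]
  simp

/-- Splitting Lebesgue measure on `ℝ^{m+n}`. -/
theorem lintegral_fin_append {m n : ℕ} {G : (Fin (m + n) → ℝ) → ℝ≥0∞} (hG : Measurable G) :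
    ∫⁻ x, G x = ∫⁻ y : Fin m → ℝ, ∫⁻ w : Fin n → ℝ, G (Fin.append y w) := by
  have h1 := volume_measurePreserving_piCongrLeft (fun _ : Fin (m + n) => ℝ)
    (finSumFinEquiv (m := m) (n := n))
  have h2 := volume_measurePreserving_sumPiEquivProdPi_symm (fun _ : Fin m ⊕ Fin n => ℝ)
  rw [← h1.lintegral_comp hG, ← h2.lintegral_comp
      (f := fun a => G (MeasurableEquiv.piCongrLeft (fun _ => ℝ) finSumFinEquiv a))
      (hG.comp h1.measurable), Measure.volume_eq_prod,
    lintegral_prod _ (by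
      exact (hG.comp (h1.measurable.comp h2.measurable)).aemeasurable)]
  refine lintegral_congr fun y => lintegral_congr fun w => congrArg G ?_
  ext i
  refine Fin.addCases (fun i => ?_) (fun i => ?_) i
  · rw [Fin.append_left]
    exact Equiv.piCongrLeft_apply_apply (fun _ : Fin (m + n) => ℝ) finSumFinEquiv _ (Sum.inl i)
  · rw [Fin.append_right]
    exact Equiv.piCongrLeft_apply_apply (fun _ : Fin (m + n) => ℝ) finSumFinEquiv _ (Sum.inr i)

theorem lintegral_comp_smul_pi {m : ℕ} {r : ℝ} (hr : 0 < r) {G : (Fin m → ℝ) → ℝ≥0∞}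
    (hG : Measurable G) :
    ∫⁻ x, G x = ENNReal.ofReal (r ^ m) * ∫⁻ z, G (r • z) := by
  rw [← lintegral_map (f := G) hG (measurable_const_smul r),
    Measure.map_addHaar_smul _ hr.ne', lintegral_smul_measure, smul_eq_mul, ← mul_assoc,
    ← ENNReal.ofReal_mul (by positivity), abs_of_pos (by positivity)]
  simp [hr.ne']

/-- The top left `m × k` block of `A`, stored by columns. -/
def corner (m k : ℕ) {N : ℕ} (A : Matrix (Fin N) (Fin N) ℝ) : Fin k → Fin m → ℝ :=
  fun j i => entryOrZero A i j

theorem measurable_corner (m k N : ℕ) :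
    Measurable (corner m k : Matrix (Fin N) (Fin N) ℝ → Fin k → Fin m → ℝ) := by
  refine measurable_pi_iff.2 fun j => measurable_pi_iff.2 fun i => ?_
  unfold corner entryOrZero
  split_ifs
  · exact measurable_matrix_entry _ _
  · exact measurable_const

theorem measurable_mulVec {N : ℕ} {α : Type*} [MeasurableSpace α]
    {F : α → Matrix (Fin N) (Fin N) ℝ} {x : α → Fin N → ℝ} (hF : Measurable F)
    (hx : Measurable x) : Measurable fun a => F a *ᵥ x a := by
  refine measurable_pi_iff.2 fun i => ?_
  simp only [Matrix.mulVec, dotProduct]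
  exact Finset.measurable_sum _ fun l _ =>
    ((measurable_matrix_entry i l).comp hF).mul ((measurable_pi_apply l).comp hx)

theorem IsOrthogonalHaar.lintegral_mulVec {N : ℕ} {μ : Measure (Matrix (Fin N) (Fin N) ℝ)}
    (hμ : IsOrthogonalHaar μ) {u : Fin N → ℝ} (hu : u ⬝ᵥ u = 1) (j : Fin N)
    {φ : (Fin N → ℝ) → ℝ≥0∞} (hφ : Measurable φ) :
    ∫⁻ A, φ (A *ᵥ u) ∂μ = ∫⁻ A, φ (A.col j) ∂μ := by
  obtain ⟨C, hC, hCj⟩ := exists_orthogonal_extension {j} (fun _ => u) (by simp [hu])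
  rw [← hμ.lintegral_mul_right (B := Cᵀ) (by rw [transpose_transpose]; exact mul_eq_one_comm.1 hC)
    (φ := fun A => φ (A.col j)) (hφ.comp (measurable_pi_iff.2 fun i => measurable_matrix_entry i j))]
  refine lintegral_congr fun A => congrArg φ ?_
  ext i
  simp [Matrix.col, Matrix.mul_apply, mulVec, dotProduct, hCj j rfl]

theorem lintegral_ball_indicator_ne_zero (N : ℕ) :
    ∫⁻ x : Fin N → ℝ, (Set.Iio (1 : ℝ)).indicator 1 (x ⬝ᵥ x) ≠ 0 := by
  have hc : Continuous fun x : Fin N → ℝ => x ⬝ᵥ x := by unfold dotProduct; fun_prop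
  have h : ∫⁻ x : Fin N → ℝ, (Set.Iio (1 : ℝ)).indicator 1 (x ⬝ᵥ x)
      = volume ((fun x : Fin N → ℝ => x ⬝ᵥ x) ⁻¹' Set.Iio 1) := by
    rw [← lintegral_indicator_one (hc.measurable measurableSet_Iio)]
    rfl
  rw [h]
  exact ((isOpen_Iio.preimage hc).measure_pos _ ⟨0, by simp⟩).ne'

theorem lintegral_ball_indicator_ne_top (N : ℕ) :
    ∫⁻ x : Fin N → ℝ, (Set.Iio (1 : ℝ)).indicator 1 (x ⬝ᵥ x) ≠ ∞ := by
  have hc : Continuous fun x : Fin N → ℝ => x ⬝ᵥ x := by unfold dotProduct; fun_prop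
  have h : ∫⁻ x : Fin N → ℝ, (Set.Iio (1 : ℝ)).indicator 1 (x ⬝ᵥ x)
      = volume ((fun x : Fin N → ℝ => x ⬝ᵥ x) ⁻¹' Set.Iio 1) := by
    rw [← lintegral_indicator_one (hc.measurable measurableSet_Iio)]
    rfl
  rw [h]
  refine ((Metric.isBounded_closedBall (x := (0 : Fin N → ℝ)) (r := 1)).subset ?_).measure_lt_top.ne
  intro x hx
  rw [mem_closedBall_zero_iff, pi_norm_le_iff_of_nonneg zero_le_one]
  intro i
  have h1 : x i * x i ≤ x ⬝ᵥ x :=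
    Finset.single_le_sum (f := fun i => x i * x i) (fun i _ => mul_self_nonneg _) (Finset.mem_univ i)
  have h2 : x ⬝ᵥ x < 1 := hx
  rw [Real.norm_eq_abs, abs_le]
  constructor <;> nlinarith

/-- The first `m` coordinates of a column of a Haar orthogonal matrix of size `m + r + 2` have
density proportional to `(1 - |z|²)_+^{r/2}`. -/
theorem IsOrthogonalHaar.exists_lintegral_col {m r : ℕ} (hr : r ≠ 0)
    {μ : Measure (Matrix (Fin (m + (r + 2))) (Fin (m + (r + 2))) ℝ)} (hμ : IsOrthogonalHaar μ)
    (j : Fin (m + (r + 2))) :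
    ∃ c : ℝ≥0∞, ∀ φ : (Fin m → ℝ) → ℝ≥0∞, Measurable φ →
      ∫⁻ A, φ (fun i => A.col j (Fin.castAdd (r + 2) i)) ∂μ
        = c * ∫⁻ z, φ z * ENNReal.ofReal (√(1 - z ⬝ᵥ z) ^ r) := by
  have := hμ.prob
  obtain ⟨C, hC⟩ := exists_lintegral_dotProduct_self r
  set h : ℝ → ℝ≥0∞ := (Set.Iio (1 : ℝ)).indicator 1 with hh
  have hhm : Measurable h := measurable_one.indicator measurableSet_Iio
  set K : ℝ≥0∞ := ∫⁻ x : Fin (m + (r + 2)) → ℝ, h (x ⬝ᵥ x) with hK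
  have hK0 : K ≠ 0 := lintegral_ball_indicator_ne_zero _
  have hKt : K ≠ ∞ := lintegral_ball_indicator_ne_top _
  set L : ℝ≥0∞ := ∫⁻ t in Set.Ioi (0 : ℝ), h t * ENNReal.ofReal (√t ^ (m + r)) with hL
  refine ⟨K⁻¹ * (C * L), fun φ hφ => ?_⟩
  have hdot : ∀ n, Measurable fun x : Fin n → ℝ => x ⬝ᵥ x := fun n => by
    unfold dotProduct; fun_prop
  let top : (Fin (m + (r + 2)) → ℝ) → Fin m → ℝ := fun x i => x (Fin.castAdd (r + 2) i)
  have htop : Measurable top := measurable_pi_iff.2 fun i => measurable_pi_apply _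
  let g : (Fin (m + (r + 2)) → ℝ) → ℝ≥0∞ := fun x => φ ((√(x ⬝ᵥ x))⁻¹ • top x)
  have hg : Measurable g :=
    hφ.comp (((hdot (m + (r + 2))).sqrt.inv).smul htop)
  have hG : Measurable fun x : Fin (m + (r + 2)) → ℝ => h (x ⬝ᵥ x) * g x :=
    (hhm.comp (hdot (m + (r + 2)))).mul hg
  have hgood : ∀ᵐ x : Fin (m + (r + 2)) → ℝ, x ≠ 0 := by
    have : Nontrivial (Fin (m + (r + 2)) → ℝ) := by
      have : Nonempty (Fin (m + (r + 2))) := ⟨j⟩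
      infer_instance
    exact Measure.ae_ne volume 0
  have h1 : ∫⁻ x : Fin (m + (r + 2)) → ℝ, ∫⁻ A, h (x ⬝ᵥ x) * g (A *ᵥ x) ∂μ
      = K * ∫⁻ A, φ (fun i => A.col j (Fin.castAdd (r + 2) i)) ∂μ := by
    rw [hK, ← lintegral_mul_const _ (f := fun x : Fin (m + (r + 2)) → ℝ => h (x ⬝ᵥ x))
      (hhm.comp (hdot (m + (r + 2))))]
    refine lintegral_congr_ae ?_
    filter_upwards [hgood] with x hx
    have hx0 : 0 < x ⬝ᵥ x := by
      have := dotProduct_self_star_pos_iff (v := x)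
      simpa using this.2 hx
    rw [lintegral_const_mul _ (f := fun A => g (A *ᵥ x))
      (hg.comp (measurable_mulVec measurable_id measurable_const))]
    congr 1
    have hu : ((√(x ⬝ᵥ x))⁻¹ • x) ⬝ᵥ ((√(x ⬝ᵥ x))⁻¹ • x) = 1 := by
      rw [smul_dotProduct, dotProduct_smul, smul_eq_mul, smul_eq_mul, ← mul_assoc, ← mul_inv,
        Real.mul_self_sqrt hx0.le, inv_mul_cancel₀ hx0.ne']
    have := hμ.lintegral_mulVec hu j (hφ.comp htop)
    rw [show ∫⁻ A, φ (fun i => A.col j (Fin.castAdd (r + 2) i)) ∂μ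
      = ∫⁻ A : Matrix (Fin (m + (r + 2))) (Fin (m + (r + 2))) ℝ, (φ ∘ top) (A.col j) ∂μ from rfl, ← this]
    refine lintegral_congr_ae ?_
    filter_upwards [hμ.ae_orthogonal] with A hA
    simp only [g, Function.comp]
    rw [dotProduct_mulVec_self_of_orthogonal hA, mulVec_smul]
    rfl
  have h2 : ∫⁻ x : Fin (m + (r + 2)) → ℝ, ∫⁻ A, h (x ⬝ᵥ x) * g (A *ᵥ x) ∂μ
      = ∫⁻ x : Fin (m + (r + 2)) → ℝ, h (x ⬝ᵥ x) * g x := by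
    rw [lintegral_lintegral_swap (by
      refine Measurable.aemeasurable ?_
      exact ((hhm.comp (hdot (m + (r + 2)))).comp measurable_fst).mul
        (hg.comp (measurable_mulVec measurable_snd measurable_fst)))]
    rw [lintegral_congr_ae (g := fun _ => ∫⁻ x : Fin (m + (r + 2)) → ℝ, h (x ⬝ᵥ x) * g x), lintegral_const,
      measure_univ, mul_one]
    filter_upwards [hμ.ae_orthogonal] with A hA
    rw [← lintegral_mulVec_of_orthogonal hA hG]
    simp only [dotProduct_mulVec_self_of_orthogonal hA]
  have happ : ∀ (y : Fin m → ℝ) (w : Fin (r + 2) → ℝ),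
      Fin.append y w ⬝ᵥ Fin.append y w = y ⬝ᵥ y + w ⬝ᵥ w := by
    intro y w
    simp [dotProduct, Fin.sum_univ_add]
  have h3 : ∫⁻ x : Fin (m + (r + 2)) → ℝ, h (x ⬝ᵥ x) * g x
      = ∫⁻ y : Fin m → ℝ, C * ∫⁻ t in Set.Ioi (0 : ℝ),
          (h t * φ ((√t)⁻¹ • y)) * ENNReal.ofReal (√(t - y ⬝ᵥ y) ^ r) := by
    rw [lintegral_fin_append hG]
    refine lintegral_congr fun y => ?_
    have hm1 : Measurable fun t : ℝ => h t * φ ((√t)⁻¹ • y) :=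
      hhm.mul (hφ.comp (Real.continuous_sqrt.measurable.inv.smul_const y))
    have := hC (fun t => h (y ⬝ᵥ y + t) * φ ((√(y ⬝ᵥ y + t))⁻¹ • y))
      (hm1.comp (measurable_const_add _))
    rw [lintegral_Ioi_add_mul_sqrt_pow hr (by
      simpa using dotProduct_self_star_nonneg y) (fun t => h t * φ ((√t)⁻¹ • y))] at this
    rw [← this]
    refine lintegral_congr fun w => ?_
    have ht : top (Fin.append y w) = y := by
      ext i; exact Fin.append_left y w i
    simp only [g, happ, ht]
  have hm2 : Measurable fun p : (Fin m → ℝ) × ℝ =>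
      (h p.2 * φ ((√p.2)⁻¹ • p.1)) * ENNReal.ofReal (√(p.2 - p.1 ⬝ᵥ p.1) ^ r) := by
    have ha : Measurable fun p : (Fin m → ℝ) × ℝ => (√p.2)⁻¹ • p.1 :=
      (measurable_snd.sqrt.inv).smul measurable_fst
    have hb : Measurable fun p : (Fin m → ℝ) × ℝ => p.1 ⬝ᵥ p.1 := (hdot m).comp measurable_fst
    exact ((hhm.comp measurable_snd).mul (hφ.comp ha)).mul
      (((measurable_snd.sub hb).sqrt.pow_const r).ennreal_ofReal)
  have h4 : ∫⁻ y : Fin m → ℝ, C * ∫⁻ t in Set.Ioi (0 : ℝ),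
          (h t * φ ((√t)⁻¹ • y)) * ENNReal.ofReal (√(t - y ⬝ᵥ y) ^ r)
      = C * (L * ∫⁻ z, φ z * ENNReal.ofReal (√(1 - z ⬝ᵥ z) ^ r)) := by
    rw [lintegral_const_mul _ hm2.lintegral_prod_right', lintegral_lintegral_swap hm2.aemeasurable,
      hL, ← lintegral_mul_const _ (by fun_prop)]
    congr 1
    refine setLIntegral_congr_fun measurableSet_Ioi fun t ht => ?_
    have ht' : 0 < √t := Real.sqrt_pos.2 ht
    rw [lintegral_comp_smul_pi ht' (by exact hm2.comp (measurable_id.prodMk measurable_const)),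
      ← lintegral_const_mul' _ _ ENNReal.ofReal_ne_top, ← lintegral_const_mul' _ _ (by
        refine ENNReal.mul_ne_top ?_ ENNReal.ofReal_ne_top
        by_cases hlt : t ∈ Set.Iio (1 : ℝ) <;> simp [hh, hlt])]
    refine lintegral_congr fun z => ?_
    have e1 : t - (√t • z) ⬝ᵥ (√t • z) = t * (1 - z ⬝ᵥ z) := by
      rw [smul_dotProduct, dotProduct_smul, smul_eq_mul, smul_eq_mul, ← mul_assoc,
        Real.mul_self_sqrt (le_of_lt ht)]
      ring
    rw [e1, Real.sqrt_mul (le_of_lt ht), mul_pow, pow_add, smul_smul, inv_mul_cancel₀ ht'.ne',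
      one_smul, ENNReal.ofReal_mul (by positivity), ENNReal.ofReal_mul (by positivity)]
    ring
  rw [mul_assoc, mul_assoc, ← h4, ← h3, ← h2, h1, ← mul_assoc, ENNReal.inv_mul_cancel hK0 hKt,
    one_mul]

/-- The positive square root of `1 - z zᵀ`, when `|z| < 1`. -/
noncomputable def contraction {m : ℕ} (z : Fin m → ℝ) : Matrix (Fin m) (Fin m) ℝ :=
  1 - (1 + √(1 - z ⬝ᵥ z))⁻¹ • vecMulVec z z

/-- The inverse of `contraction z`, when `|z| < 1`. -/
noncomputable def expansion {m : ℕ} (z : Fin m → ℝ) : Matrix (Fin m) (Fin m) ℝ :=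
  1 + (√(1 - z ⬝ᵥ z) * (1 + √(1 - z ⬝ᵥ z)))⁻¹ • vecMulVec z z

theorem dotProduct_self_nonneg_real {m : ℕ} (z : Fin m → ℝ) : 0 ≤ z ⬝ᵥ z :=
  Finset.sum_nonneg fun _ _ => mul_self_nonneg _

theorem vecMulVec_self_mul_self {m : ℕ} (z : Fin m → ℝ) :
    vecMulVec z z * vecMulVec z z = (z ⬝ᵥ z) • vecMulVec z z := by
  ext i j
  simp only [Matrix.mul_apply, vecMulVec_apply, Matrix.smul_apply, smul_eq_mul, dotProduct,
    Finset.sum_mul]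
  exact Finset.sum_congr rfl fun _ _ => by ring

theorem vecMulVec_self_mulVec {m : ℕ} (z x : Fin m → ℝ) :
    vecMulVec z z *ᵥ x = (z ⬝ᵥ x) • z := by
  ext i
  simp only [mulVec, vecMulVec_apply, Pi.smul_apply, smul_eq_mul, dotProduct, Finset.sum_mul]
  exact Finset.sum_congr rfl fun _ _ => by ring

theorem contraction_mul_self {m : ℕ} {z : Fin m → ℝ} (hz : z ⬝ᵥ z ≤ 1) :
    contraction z * contraction z = 1 - vecMulVec z z := by
  have hs := Real.sq_sqrt (sub_nonneg.2 hz)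
  have hs0 := Real.sqrt_nonneg (1 - z ⬝ᵥ z)
  have hzz : z ⬝ᵥ z = 1 - √(1 - z ⬝ᵥ z) ^ 2 := by linarith
  unfold contraction
  generalize √(1 - z ⬝ᵥ z) = s at *
  rw [sub_mul, mul_sub, mul_sub, one_mul, mul_one, one_mul, Matrix.smul_mul, Matrix.mul_smul,
    vecMulVec_self_mul_self, hzz, smul_smul, smul_smul]
  rw [← sub_eq_zero]
  have : (1 + s)⁻¹ * (1 + s)⁻¹ * (1 - s ^ 2) = 2 * (1 + s)⁻¹ - 1 := by
    field_simp
    ring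
  rw [this]
  module

theorem expansion_mul_contraction {m : ℕ} {z : Fin m → ℝ} (hz : z ⬝ᵥ z < 1) :
    expansion z * contraction z = 1 := by
  have hs := Real.sq_sqrt (sub_nonneg.2 hz.le)
  have hs0 := Real.sqrt_pos.2 (sub_pos.2 hz)
  have hzz : z ⬝ᵥ z = 1 - √(1 - z ⬝ᵥ z) ^ 2 := by linarith
  unfold contraction expansion
  generalize √(1 - z ⬝ᵥ z) = s at *
  rw [mul_sub, mul_one, Matrix.mul_smul, add_mul, one_mul, Matrix.smul_mul,
    vecMulVec_self_mul_self, hzz, smul_smul, smul_add, smul_smul]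
  have : (1 + s)⁻¹ * ((s * (1 + s))⁻¹ * (1 - s ^ 2)) = (s * (1 + s))⁻¹ - (1 + s)⁻¹ := by
    field_simp
    ring
  rw [this]
  module

theorem contraction_mul_expansion {m : ℕ} {z : Fin m → ℝ} (hz : z ⬝ᵥ z < 1) :
    contraction z * expansion z = 1 :=
  mul_eq_one_comm.1 (expansion_mul_contraction hz)

theorem expansion_transpose {m : ℕ} (z : Fin m → ℝ) : (expansion z)ᵀ = expansion z := by
  simp [expansion, transpose_vecMulVec]

theorem expansion_mul_sub_mul_expansion {m : ℕ} {z : Fin m → ℝ} (hz : z ⬝ᵥ z < 1) :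
    expansion z * (1 - vecMulVec z z) * expansion z = 1 := by
  rw [← contraction_mul_self hz.le, ← Matrix.mul_assoc, expansion_mul_contraction hz, one_mul,
    contraction_mul_expansion hz]

theorem det_contraction {m : ℕ} {z : Fin m → ℝ} (hz : z ⬝ᵥ z ≤ 1) :
    (contraction z).det = √(1 - z ⬝ᵥ z) := by
  have hs := Real.sq_sqrt (sub_nonneg.2 hz)
  have hs0 := Real.sqrt_nonneg (1 - z ⬝ᵥ z)
  have h : contraction z = 1 + replicateCol Unit (-(1 + √(1 - z ⬝ᵥ z))⁻¹ • z)
      * replicateRow Unit z := by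
    rw [contraction, ← vecMulVec_eq, smul_vecMulVec, neg_smul, sub_eq_add_neg]
  rw [h, det_one_add_replicateCol_mul_replicateRow, dotProduct_smul, smul_eq_mul]
  have hzz : z ⬝ᵥ z = 1 - √(1 - z ⬝ᵥ z) ^ 2 := by linarith
  generalize √(1 - z ⬝ᵥ z) = s at *
  rw [hzz]
  field_simp
  ring

theorem expansion_mulVec {m : ℕ} (z x : Fin m → ℝ) :
    expansion z *ᵥ x
      = x + ((√(1 - z ⬝ᵥ z) * (1 + √(1 - z ⬝ᵥ z)))⁻¹ * (z ⬝ᵥ x)) • z := by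
  rw [expansion, add_mulVec, one_mulVec, smul_mulVec, vecMulVec_self_mulVec, smul_smul]

theorem contraction_mulVec {m : ℕ} (z x : Fin m → ℝ) :
    contraction z *ᵥ x = x - ((1 + √(1 - z ⬝ᵥ z))⁻¹ * (z ⬝ᵥ x)) • z := by
  rw [contraction, sub_mulVec, one_mulVec, smul_mulVec, vecMulVec_self_mulVec, smul_smul]

theorem dotProduct_expansion_mulVec {m : ℕ} {z : Fin m → ℝ} (hz : z ⬝ᵥ z < 1) (x : Fin m → ℝ) :
    (expansion z *ᵥ x) ⬝ᵥ (expansion z *ᵥ x)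
      = x ⬝ᵥ x + (z ⬝ᵥ x) ^ 2 / (1 - z ⬝ᵥ z) := by
  have hs := Real.sq_sqrt (sub_nonneg.2 hz.le)
  have hs0 := Real.sqrt_pos.2 (sub_pos.2 hz)
  have hzz : z ⬝ᵥ z = 1 - √(1 - z ⬝ᵥ z) ^ 2 := by linarith
  rw [expansion_mulVec]
  simp only [add_dotProduct, dotProduct_add, smul_dotProduct, dotProduct_smul, smul_eq_mul,
    dotProduct_comm x z]
  generalize √(1 - z ⬝ᵥ z) = s at *
  rw [hzz]
  field_simp
  ring

/-- For a matrix `Z` with columns `Z j` this is `det (1 - Z Zᵀ) ^ (1/2)` when `1 - Z Zᵀ` is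
positive definite, computed by eliminating one column at a time. -/
noncomputable def rootDet {m : ℕ} : (k : ℕ) → (Fin k → Fin m → ℝ) → ℝ
  | 0, _ => 1
  | k + 1, Z => √(1 - Z 0 ⬝ᵥ Z 0) * rootDet k fun j => expansion (Z 0) *ᵥ Z j.succ

theorem measurable_dotProduct {m : ℕ} {α : Type*} [MeasurableSpace α] {f g : α → Fin m → ℝ}
    (hf : Measurable f) (hg : Measurable g) : Measurable fun a => f a ⬝ᵥ g a := by
  unfold dotProduct
  fun_prop

theorem measurable_rootDet (m k : ℕ) :
    Measurable (rootDet k : (Fin k → Fin m → ℝ) → ℝ) := by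
  induction k with
  | zero => exact measurable_const
  | succ k ih =>
    have hd : ∀ i j : Fin (k + 1), Measurable fun Z : Fin (k + 1) → Fin m → ℝ => Z i ⬝ᵥ Z j :=
      fun i j => measurable_dotProduct (measurable_pi_apply i) (measurable_pi_apply j)
    have hs : Measurable fun Z : Fin (k + 1) → Fin m → ℝ => √(1 - Z 0 ⬝ᵥ Z 0) :=
      (measurable_const.sub (hd 0 0)).sqrt
    refine hs.mul (ih.comp (measurable_pi_iff.2 fun j => ?_))
    simp only [expansion_mulVec]
    exact (measurable_pi_apply _).add
      (((hs.mul (measurable_const.add hs)).inv.mul (hd 0 j.succ)).smul (measurable_pi_apply _))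

theorem rootDet_nonneg {m : ℕ} (k : ℕ) (Z : Fin k → Fin m → ℝ) : 0 ≤ rootDet k Z := by
  induction k with
  | zero => exact zero_le_one
  | succ k ih => exact mul_nonneg (Real.sqrt_nonneg _) (ih _)

theorem rootDet_le_exp {m : ℕ} (k : ℕ) (Z : Fin k → Fin m → ℝ) :
    rootDet k Z ≤ Real.exp (-(∑ j, Z j ⬝ᵥ Z j) / 2) := by
  induction k with
  | zero => simp [rootDet]
  | succ k ih =>
    rw [rootDet]
    rcases le_or_gt 1 (Z 0 ⬝ᵥ Z 0) with h | h
    · rw [Real.sqrt_eq_zero_of_nonpos (by linarith), zero_mul]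
      positivity
    · have h1 : √(1 - Z 0 ⬝ᵥ Z 0) ≤ Real.exp (-(Z 0 ⬝ᵥ Z 0) / 2) := by
        rw [Real.sqrt_le_left (by positivity), ← Real.exp_nat_mul]
        have := Real.add_one_le_exp (-(Z 0 ⬝ᵥ Z 0))
        refine le_trans (by linarith) (this.trans_eq ?_)
        congr 1
        push_cast
        ring
      have h2 := ih fun j => expansion (Z 0) *ᵥ Z j.succ
      refine (mul_le_mul h1 h2 (rootDet_nonneg _ _) (by positivity)).trans ?_
      rw [← Real.exp_add, Real.exp_le_exp, Fin.sum_univ_succ]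
      have h3 : ∑ j : Fin k, Z j.succ ⬝ᵥ Z j.succ
          ≤ ∑ j : Fin k, (expansion (Z 0) *ᵥ Z j.succ) ⬝ᵥ (expansion (Z 0) *ᵥ Z j.succ) := by
        refine Finset.sum_le_sum fun j _ => ?_
        rw [dotProduct_expansion_mulVec h]
        have := div_nonneg (sq_nonneg (Z 0 ⬝ᵥ Z j.succ)) (sub_nonneg.2 h.le)
        linarith
      linarith

theorem le_rootDet_sq {m : ℕ} (k : ℕ) (Z : Fin k → Fin m → ℝ) :
    1 - ∑ j, Z j ⬝ᵥ Z j ≤ rootDet k Z ^ 2 := by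
  induction k with
  | zero => simp [rootDet]
  | succ k ih =>
    rw [rootDet, Fin.sum_univ_succ]
    have hS : 0 ≤ ∑ j : Fin k, Z j.succ ⬝ᵥ Z j.succ :=
      Finset.sum_nonneg fun j _ => dotProduct_self_nonneg_real _
    rcases le_or_gt 1 (Z 0 ⬝ᵥ Z 0) with h | h
    · exact le_trans (by linarith) (sq_nonneg _)
    · have h2 := ih fun j => expansion (Z 0) *ᵥ Z j.succ
      have h0 : 0 < 1 - Z 0 ⬝ᵥ Z 0 := sub_pos.2 h
      rw [mul_pow, Real.sq_sqrt h0.le]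
      have h3 : ∑ j : Fin k, (expansion (Z 0) *ᵥ Z j.succ) ⬝ᵥ (expansion (Z 0) *ᵥ Z j.succ)
          ≤ (∑ j : Fin k, Z j.succ ⬝ᵥ Z j.succ) / (1 - Z 0 ⬝ᵥ Z 0) := by
        rw [Finset.sum_div]
        refine Finset.sum_le_sum fun j _ => ?_
        rw [dotProduct_expansion_mulVec h, le_div_iff₀ h0, add_mul, div_mul_cancel₀ _ h0.ne']
        have hcs : (Z 0 ⬝ᵥ Z j.succ) ^ 2 ≤ (Z 0 ⬝ᵥ Z 0) * (Z j.succ ⬝ᵥ Z j.succ) := by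
          have := Finset.sum_mul_sq_le_sq_mul_sq Finset.univ (Z 0) (Z j.succ)
          simpa [dotProduct, sq] using this
        linarith
      rw [le_div_iff₀ h0] at h3
      nlinarith

theorem corner_apply {m k N : ℕ} (hm : m ≤ N) (hk : k ≤ N) (A : Matrix (Fin N) (Fin N) ℝ)
    (j : Fin k) (i : Fin m) : corner m k A j i = A (Fin.castLE hm i) (Fin.castLE hk j) := by
  rw [corner, entryOrZero, dif_pos ⟨i.2.trans_le hm, j.2.trans_le hk⟩]
  rfl

/-- The block diagonal matrix with blocks `1` and `A`. -/
def oneBlock {n : ℕ} (A : Matrix (Fin n) (Fin n) ℝ) : Matrix (Fin (n + 1)) (Fin (n + 1)) ℝ :=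
  Matrix.of (Fin.cons (Fin.cons 1 0) fun i => Fin.cons 0 (A i))

theorem oneBlock_mul_transpose {n : ℕ} {A : Matrix (Fin n) (Fin n) ℝ} (hA : A * Aᵀ = 1) :
    oneBlock A * (oneBlock A)ᵀ = 1 := by
  ext i j
  have h := fun i j => congrFun₂ hA i j
  simp only [Matrix.mul_apply, transpose_apply] at h
  refine Fin.cases ?_ (fun i => ?_) i <;> refine Fin.cases ?_ (fun j => ?_) j <;>
    simp [oneBlock, Matrix.mul_apply, Fin.sum_univ_succ, h, Matrix.one_apply,
      (Fin.succ_ne_zero _).symm]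

theorem measurable_oneBlock (n : ℕ) :
    Measurable (oneBlock : Matrix (Fin n) (Fin n) ℝ → Matrix (Fin (n + 1)) (Fin (n + 1)) ℝ) := by
  refine measurable_matrix_of_entries fun i j => ?_
  refine Fin.cases ?_ (fun i => ?_) i <;> refine Fin.cases ?_ (fun j => ?_) j <;>
    simp [oneBlock, measurable_matrix_entry]

theorem mul_oneBlock_zero {n : ℕ} (A : Matrix (Fin (n + 1)) (Fin (n + 1)) ℝ)
    (B : Matrix (Fin n) (Fin n) ℝ) (i : Fin (n + 1)) : (A * oneBlock B) i 0 = A i 0 := by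
  simp [oneBlock, Matrix.mul_apply, Fin.sum_univ_succ]

theorem mul_oneBlock_succ {n : ℕ} (A : Matrix (Fin (n + 1)) (Fin (n + 1)) ℝ)
    (B : Matrix (Fin n) (Fin n) ℝ) (i : Fin (n + 1)) (j : Fin n) :
    (A * oneBlock B) i j.succ = ∑ l, A i l.succ * B l j := by
  simp [oneBlock, Matrix.mul_apply, Fin.sum_univ_succ]

/-- An orthogonal matrix whose first column has top part `z` factors, up to an orthogonal
transformation of the remaining columns, through `contraction z`. -/
theorem exists_corner_mul_oneBlock {m n : ℕ} (hm : m ≤ n)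
    {A : Matrix (Fin (n + 1)) (Fin (n + 1)) ℝ} (hA : A * Aᵀ = 1)
    (hz : corner m 1 A 0 ⬝ᵥ corner m 1 A 0 < 1) :
    ∃ C : Matrix (Fin n) (Fin n) ℝ, C * Cᵀ = 1 ∧ ∀ k ≤ n, ∀ B : Matrix (Fin n) (Fin n) ℝ,
      corner m (k + 1) (A * oneBlock B) = Fin.cons (corner m 1 A 0)
        fun j => contraction (corner m 1 A 0) *ᵥ corner m k (C * B) j := by
  have hm1 : m ≤ n + 1 := hm.trans n.le_succ
  set z : Fin m → ℝ := corner m 1 A 0 with hzdef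
  have hzi : ∀ i, z i = A (Fin.castLE hm1 i) 0 := fun i =>
    corner_apply hm1 (by omega) A 0 i
  let R : Matrix (Fin m) (Fin n) ℝ := Matrix.of fun i l => A (Fin.castLE hm1 i) l.succ
  have hR : R * Rᵀ = 1 - vecMulVec z z := by
    ext i j
    have h := congrFun₂ hA (Fin.castLE hm1 i) (Fin.castLE hm1 j)
    rw [Matrix.mul_apply, Fin.sum_univ_succ] at h
    simp only [Matrix.sub_apply, vecMulVec_apply, hzi, Matrix.mul_apply, R, transpose_apply,
      of_apply, Matrix.one_apply, Fin.castLE_inj] at h ⊢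
    linarith
  let C : Matrix (Fin m) (Fin n) ℝ := expansion z * R
  have hC : C * Cᵀ = 1 := by
    rw [transpose_mul, expansion_transpose, ← Matrix.mul_assoc, Matrix.mul_assoc (expansion z),
      hR, expansion_mul_sub_mul_expansion hz]
  obtain ⟨D, hD, hDC⟩ := exists_orthogonal_extension {i : Fin n | (i : ℕ) < m}
    (fun i => if h : (i : ℕ) < m then C ⟨i, h⟩ else 0) (fun i hi j hj => by
      rw [Set.mem_ofPred_eq] at hi hj
      rw [dif_pos hi, dif_pos hj]
      have := congrFun₂ hC ⟨i, hi⟩ ⟨j, hj⟩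
      rw [Matrix.mul_apply, Matrix.one_apply] at this
      simpa [dotProduct, Fin.ext_iff] using this)
  have hDC' : ∀ i : Fin m, D (Fin.castLE hm i) = C i := fun i =>
    have h : ((Fin.castLE hm i : Fin n) : ℕ) < m := i.2
    (hDC _ h).trans (dif_pos h)
  refine ⟨D, hD, fun k hk B => ?_⟩
  ext j i
  rw [corner_apply hm1 (Nat.succ_le_succ hk)]
  refine Fin.cases ?_ (fun j => ?_) j
  · rw [Fin.cons_zero, hzi]
    exact mul_oneBlock_zero A B _
  · rw [Fin.cons_succ]
    have h1 : (corner m k (D * B) j) = (C * B) *ᵥ Pi.single (Fin.castLE hk j) 1 := by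
      ext i
      rw [corner_apply hm hk, mulVec_single_one, Matrix.col_apply, Matrix.mul_apply,
        Matrix.mul_apply, hDC']
    rw [h1, mulVec_mulVec, ← Matrix.mul_assoc, ← Matrix.mul_assoc, contraction_mul_expansion hz,
      Matrix.one_mul, mulVec_single_one, Matrix.col_apply, Matrix.mul_apply (M := R)]
    exact mul_oneBlock_succ A B (Fin.castLE hm1 i) (Fin.castLE hk j)

theorem measurable_cons_contraction {m k : ℕ} :
    Measurable fun p : (Fin m → ℝ) × (Fin k → Fin m → ℝ) =>
      (Fin.cons p.1 fun j => contraction p.1 *ᵥ p.2 j : Fin (k + 1) → Fin m → ℝ) := by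
  refine measurable_pi_iff.2 fun j => ?_
  refine Fin.cases ?_ (fun j => ?_) j
  · simpa using measurable_fst
  · have hj : Measurable fun p : (Fin m → ℝ) × (Fin k → Fin m → ℝ) => p.2 j :=
      (measurable_pi_apply j).comp measurable_snd
    simp only [Fin.cons_succ, contraction_mulVec]
    exact hj.sub ((((measurable_const.add (measurable_const.sub
      (measurable_dotProduct measurable_fst measurable_fst)).sqrt).inv).mul
      (measurable_dotProduct measurable_fst hj)).smul measurable_fst)

theorem IsOrthogonalHaar.lintegral_corner_succ {m n k : ℕ} (hm : m ≤ n) (hk : k ≤ n)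
    {μ : Measure (Matrix (Fin (n + 1)) (Fin (n + 1)) ℝ)} (hμ : IsOrthogonalHaar μ)
    {ν : Measure (Matrix (Fin n) (Fin n) ℝ)} (hν : IsOrthogonalHaar ν)
    (hlt : ∀ᵐ A ∂μ, corner m 1 A 0 ⬝ᵥ corner m 1 A 0 < 1)
    {φ : (Fin (k + 1) → Fin m → ℝ) → ℝ≥0∞} (hφ : Measurable φ) :
    ∫⁻ A, φ (corner m (k + 1) A) ∂μ = ∫⁻ A, ∫⁻ B, φ (Fin.cons (corner m 1 A 0)
      fun j => contraction (corner m 1 A 0) *ᵥ corner m k B j) ∂ν ∂μ := by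
  have := hμ.prob
  have := hν.prob
  have h1 : ∫⁻ B, ∫⁻ A, φ (corner m (k + 1) (A * oneBlock B)) ∂μ ∂ν
      = ∫⁻ A, φ (corner m (k + 1) A) ∂μ := by
    rw [lintegral_congr_ae (g := fun _ => ∫⁻ A, φ (corner m (k + 1) A) ∂μ), lintegral_const,
      measure_univ, mul_one]
    filter_upwards [hν.ae_orthogonal] with B hB
    exact hμ.lintegral_mul_right (oneBlock_mul_transpose hB)
      (hφ.comp (measurable_corner m (k + 1) (n + 1)))
  rw [← h1, lintegral_lintegral_swap (f := fun B A => φ (corner m (k + 1) (A * oneBlock B)))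
    (Measurable.aemeasurable ((hφ.comp (measurable_corner m (k + 1) (n + 1))).comp
      (measurable_snd.matrix_mul ((measurable_oneBlock n).comp measurable_fst))))]
  refine lintegral_congr_ae ?_
  filter_upwards [hμ.ae_orthogonal, hlt] with A hA hAz
  obtain ⟨C, hC, hCB⟩ := exists_corner_mul_oneBlock hm hA hAz
  simp only [hCB k hk]
  exact hν.lintegral_mul_left hC (φ := fun B => φ (Fin.cons (corner m 1 A 0)
      fun j => contraction (corner m 1 A 0) *ᵥ corner m k B j))
    (hφ.comp (measurable_cons_contraction.comp
      (measurable_const.prodMk (measurable_corner m k n))))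

theorem ofReal_mul_lintegral_contraction {m k : ℕ} {z : Fin m → ℝ} (hz : z ⬝ᵥ z < 1)
    {H : (Fin k → Fin m → ℝ) → ℝ≥0∞} (hH : Measurable H) :
    ENNReal.ofReal (√(1 - z ⬝ᵥ z) ^ k) * ∫⁻ Z : Fin k → Fin m → ℝ, H (fun j => contraction z *ᵥ Z j)
      = ∫⁻ Z, H Z := by
  have hs0 := Real.sqrt_pos.2 (sub_pos.2 hz)
  let L : (Fin k → Fin m → ℝ) →ₗ[ℝ] (Fin k → Fin m → ℝ) :=
    LinearMap.pi fun j => (toLin' (contraction z)).comp (LinearMap.proj j)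
  have hdet : L.det = √(1 - z ⬝ᵥ z) ^ k := by
    rw [LinearMap.det_pi]
    simp [LinearMap.det_toLin', det_contraction hz.le]
  have hL : Measurable L := L.continuous_of_finiteDimensional.measurable
  have hmap := Measure.map_linearMap_addHaar_eq_smul_addHaar
    (volume : Measure (Fin k → Fin m → ℝ)) (f := L) (by rw [hdet]; positivity)
  have h1 : ∫⁻ Z : Fin k → Fin m → ℝ, H (fun j => contraction z *ᵥ Z j)
      = ENNReal.ofReal |L.det⁻¹| * ∫⁻ Z, H Z := by
    rw [← smul_eq_mul, ← lintegral_smul_measure, ← hmap, lintegral_map hH hL]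
    rfl
  rw [h1, hdet, ← mul_assoc, ← ENNReal.ofReal_mul (by positivity), abs_of_pos (by positivity),
    mul_inv_cancel₀ (by positivity), ENNReal.ofReal_one, one_mul]

theorem measurable_fin_cons {α : Type*} [MeasurableSpace α] {k : ℕ} :
    Measurable fun p : α × (Fin k → α) => (Fin.cons p.1 p.2 : Fin (k + 1) → α) := by
  refine measurable_pi_iff.2 fun j => ?_
  refine Fin.cases ?_ (fun j => ?_) j
  · simpa using measurable_fst
  · simp only [Fin.cons_succ]
    exact (measurable_pi_apply j).comp measurable_snd

theorem lintegral_fin_cons {α : Type*} [MeasureSpace α] [SigmaFinite (volume : Measure α)] {k : ℕ}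
    {G : (Fin (k + 1) → α) → ℝ≥0∞} (hG : Measurable G) :
    ∫⁻ Z, G Z = ∫⁻ z, ∫⁻ Z', G (Fin.cons z Z') := by
  have h := (volume_preserving_piFinSuccAbove (fun _ : Fin (k + 1) => α) 0).symm
  rw [← h.lintegral_comp hG]
  have h1 : ∀ p : α × (Fin k → α),
      (MeasurableEquiv.piFinSuccAbove (fun _ : Fin (k + 1) => α) 0).symm p
        = Fin.cons p.1 p.2 := fun p => Fin.insertNth_zero' p.1 p.2
  refine (lintegral_congr fun p => congrArg G (h1 p)).trans ?_
  exact lintegral_prod (μ := (volume : Measure α)) (ν := (volume : Measure (Fin k → α)))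
    (fun p => G (Fin.cons p.1 p.2)) (hG.comp measurable_fin_cons).aemeasurable

theorem IsOrthogonalHaar.exists_lintegral_first_col {N m r : ℕ} (hr : r ≠ 0)
    (hN : N = m + (r + 2)) {μ : Measure (Matrix (Fin N) (Fin N) ℝ)} (hμ : IsOrthogonalHaar μ) :
    ∃ c : ℝ≥0∞, ∀ φ : (Fin m → ℝ) → ℝ≥0∞, Measurable φ →
      ∫⁻ A, φ (corner m 1 A 0) ∂μ = c * ∫⁻ z, φ z * ENNReal.ofReal (√(1 - z ⬝ᵥ z) ^ r) := by
  subst hN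
  obtain ⟨c, hc⟩ := hμ.exists_lintegral_col hr ⟨0, by omega⟩
  refine ⟨c, fun φ hφ => ?_⟩
  rw [← hc φ hφ]
  have h : ∀ A : Matrix (Fin (m + (r + 2))) (Fin (m + (r + 2))) ℝ,
      corner m 1 A 0 = fun i => A.col ⟨0, by omega⟩ (Fin.castAdd (r + 2) i) := fun A => by
    ext i
    rw [corner_apply (by omega) (by omega)]
    rfl
  simp only [h]

/-- The top left `m × k` corner of a Haar orthogonal matrix of size `q + m + k + 1` has density
proportional to `det (1 - Z Zᵀ) ^ (q / 2)`. -/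
theorem exists_lintegral_corner {μ : ∀ N, Measure (Matrix (Fin N) (Fin N) ℝ)}
    (hμ : ∀ N, IsOrthogonalHaar (μ N)) {q : ℕ} (hq : q ≠ 0) (m k : ℕ) :
    ∃ c : ℝ≥0∞, ∀ φ : (Fin k → Fin m → ℝ) → ℝ≥0∞, Measurable φ →
      ∫⁻ A, φ (corner m k A) ∂(μ (q + m + k + 1))
        = c * ∫⁻ Z, φ Z * ENNReal.ofReal (rootDet k Z ^ q) := by
  induction k with
  | zero =>
    refine ⟨1, fun φ hφ => ?_⟩
    have := (hμ (q + m + 0 + 1)).prob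
    have h : ∀ A : Matrix (Fin (q + m + 0 + 1)) (Fin (q + m + 0 + 1)) ℝ,
      corner m 0 A = default := fun A => Subsingleton.elim _ _
    simp only [h, lintegral_const, measure_univ, mul_one, rootDet, one_pow, ENNReal.ofReal_one,
      one_mul]
    rw [volume_pi, Measure.pi_of_empty _ default, lintegral_dirac' _ hφ]
  | succ k ih =>
    obtain ⟨c, hc⟩ := ih
    change ∃ c : ℝ≥0∞, ∀ φ : (Fin (k + 1) → Fin m → ℝ) → ℝ≥0∞, Measurable φ →
      ∫⁻ A, φ (corner m (k + 1) A) ∂(μ (q + m + k + 1 + 1)) = _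
    obtain ⟨c₁, hc₁⟩ := (hμ (q + m + k + 1 + 1)).exists_lintegral_first_col (m := m)
      (r := q + k) (by omega) (by omega)
    refine ⟨c₁ * c, fun φ hφ => ?_⟩
    have hset : MeasurableSet {z : Fin m → ℝ | 1 ≤ z ⬝ᵥ z} :=
      measurableSet_le measurable_const (measurable_dotProduct measurable_id measurable_id)
    have hlt : ∀ᵐ A ∂(μ (q + m + k + 1 + 1)), corner m 1 A 0 ⬝ᵥ corner m 1 A 0 < 1 := by
      have h0 := hc₁ (Set.indicator {z | 1 ≤ z ⬝ᵥ z} 1) (measurable_one.indicator hset)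
      have h1 : ∀ z : Fin m → ℝ, Set.indicator {z | 1 ≤ z ⬝ᵥ z} 1 z
          * ENNReal.ofReal (√(1 - z ⬝ᵥ z) ^ (q + k)) = 0 := fun z => by
        by_cases hz : 1 ≤ z ⬝ᵥ z
        · rw [Real.sqrt_eq_zero_of_nonpos (by linarith), zero_pow (by omega), ENNReal.ofReal_zero,
            mul_zero]
        · rw [Set.indicator_of_notMem (by exact hz), zero_mul]
      simp only [h1, lintegral_zero, mul_zero] at h0
      have h2 := (lintegral_eq_zero_iff ((measurable_one.indicator hset).comp
        ((measurable_pi_apply 0).comp (measurable_corner m 1 _)))).1 h0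
      filter_upwards [h2] with A hA
      by_contra hcon
      exact one_ne_zero ((Set.indicator_of_mem (show corner m 1 A 0 ∈ {z : Fin m → ℝ | 1 ≤ z ⬝ᵥ z}
        from not_lt.1 hcon) 1).symm.trans hA)
    have hcons := hφ.comp (measurable_cons_contraction (m := m) (k := k))
    have hdet := ((measurable_rootDet m k).pow_const q).ennreal_ofReal
    rw [(hμ (q + m + k + 1 + 1)).lintegral_corner_succ (n := q + m + k + 1) (by omega)
      (by omega) (hμ _) hlt hφ]
    have hstep : ∀ z : Fin m → ℝ, ∫⁻ B, φ (Fin.cons z fun j => contraction z *ᵥ corner m k B j)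
        ∂(μ (q + m + k + 1)) = c * ∫⁻ Z : Fin k → Fin m → ℝ,
          φ (Fin.cons z fun j => contraction z *ᵥ Z j) * ENNReal.ofReal (rootDet k Z ^ q) :=
      fun z => hc (fun Z => φ (Fin.cons z fun j => contraction z *ᵥ Z j))
        (hcons.comp (measurable_const.prodMk measurable_id))
    simp only [hstep]
    rw [hc₁ (fun z => c * ∫⁻ Z : Fin k → Fin m → ℝ,
      φ (Fin.cons z fun j => contraction z *ᵥ Z j) * ENNReal.ofReal (rootDet k Z ^ q))
      (Measurable.const_mul (Measurable.lintegral_prod_right'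
        (f := fun p : (Fin m → ℝ) × (Fin k → Fin m → ℝ) =>
          φ (Fin.cons p.1 fun j => contraction p.1 *ᵥ p.2 j) * ENNReal.ofReal (rootDet k p.2 ^ q))
        (hcons.mul (hdet.comp measurable_snd))) c)]
    have hdet1 := ((measurable_rootDet m (k + 1)).pow_const q).ennreal_ofReal
    have hmul : Measurable fun Z => φ Z * ENNReal.ofReal (rootDet (k + 1) Z ^ q) := hφ.mul hdet1
    have hfin := measurable_fin_cons (α := Fin m → ℝ) (k := k)
    rw [mul_assoc, lintegral_fin_cons hmul,
      ← lintegral_const_mul c (Measurable.lintegral_prod_right'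
        (f := fun p : (Fin m → ℝ) × (Fin k → Fin m → ℝ) =>
          φ (Fin.cons p.1 p.2) * ENNReal.ofReal (rootDet (k + 1) (Fin.cons p.1 p.2) ^ q))
        (hmul.comp hfin))]
    refine congrArg (c₁ * ·) (lintegral_congr fun z => ?_)
    rw [mul_assoc]
    refine congrArg (c * ·) ?_
    simp only [rootDet, Fin.cons_zero, Fin.cons_succ]
    rcases le_or_gt 1 (z ⬝ᵥ z) with hz | hz
    · simp [Real.sqrt_eq_zero_of_nonpos (sub_nonpos.2 hz), hq]
    · have hmv : Measurable fun Z : Fin k → Fin m → ℝ => fun j => expansion z *ᵥ Z j :=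
        measurable_pi_iff.2 fun j =>
          (Continuous.matrix_mulVec continuous_const continuous_id).measurable.comp
            (measurable_pi_apply j)
      have hH := ofReal_mul_lintegral_contraction hz
        ((hφ.comp (hfin.comp ((measurable_const (a := z)).prodMk measurable_id))).mul
          (hdet.comp hmv))
      simp only [Pi.mul_apply, Function.comp_apply, id_eq, mulVec_mulVec,
        expansion_mul_contraction hz, one_mulVec] at hH
      have hs := Real.sqrt_nonneg (1 - z ⬝ᵥ z)
      rw [mul_comm, pow_add, ENNReal.ofReal_mul (by positivity), mul_assoc, hH]
      simp only [mul_pow, ENNReal.ofReal_mul (pow_nonneg hs q)]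
      rw [← lintegral_const_mul' _ _ ENNReal.ofReal_ne_top]
      exact lintegral_congr fun Z => mul_left_comm _ _ _

theorem lintegral_fin_prod {α : Type*} [MeasureSpace α] [SigmaFinite (volume : Measure α)]
    {G : α → ℝ≥0∞} (hG : Measurable G) (n : ℕ) :
    ∫⁻ Z : Fin n → α, ∏ i, G (Z i) = (∫⁻ z, G z) ^ n := by
  induction n with
  | zero =>
    simp only [Finset.univ_eq_empty, Finset.prod_empty, lintegral_const, one_mul, pow_zero]
    rw [volume_pi, Measure.pi_of_empty _ (default : Fin 0 → α), measure_univ]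
  | succ n ih =>
    have hm : ∀ n, Measurable fun Z : Fin n → α => ∏ i, G (Z i) := fun n =>
      Finset.measurable_prod _ fun i _ => hG.comp (measurable_pi_apply i)
    rw [lintegral_fin_cons (hm _)]
    simp only [Fin.prod_univ_succ, Fin.cons_zero, Fin.cons_succ]
    simp_rw [lintegral_const_mul _ (hm n), ih]
    rw [lintegral_mul_const _ hG, pow_succ']

theorem lintegral_exp_sum_sum {h : ℝ → ℝ} (hh : Measurable h) (m k : ℕ) :
    ∫⁻ Z : Fin k → Fin m → ℝ, ENNReal.ofReal (Real.exp (∑ j, ∑ i, h (Z j i)))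
      = (∫⁻ z, ENNReal.ofReal (Real.exp (h z))) ^ (m * k) := by
  have hG : Measurable fun z => ENNReal.ofReal (Real.exp (h z)) := hh.exp.ennreal_ofReal
  rw [pow_mul, ← lintegral_fin_prod hG, ← lintegral_fin_prod
    (G := fun z : Fin m → ℝ => ∏ i, ENNReal.ofReal (Real.exp (h (z i))))
    (Finset.measurable_prod _ fun i _ => hG.comp (measurable_pi_apply i))]
  simp only [Real.exp_sum, ENNReal.ofReal_prod_of_nonneg (fun _ _ => Finset.prod_nonneg
    fun _ _ => (Real.exp_pos _).le), ENNReal.ofReal_prod_of_nonneg (fun _ _ => (Real.exp_pos _).le)]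

/-- The integral of `exp ∘ g` against the unnormalised centred Gaussian weight of variance
`1 / t`. -/
noncomputable def gaussInt (g : ℝ → ℝ) (t : ℝ) : ℝ := ∫ y, Real.exp (g y - t * y ^ 2 / 2)

theorem integrable_exp_sub_sq {g : ℝ → ℝ} (hg : Measurable g) {M : ℝ} (hM : ∀ x, |g x| ≤ M)
    {t : ℝ} (ht : 0 < t) : Integrable fun y => Real.exp (g y - t * y ^ 2 / 2) := by
  refine ((integrable_exp_neg_mul_sq (half_pos ht)).const_mul (Real.exp M)).mono'
    (by fun_prop) (Eventually.of_forall fun y => ?_)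
  rw [Real.norm_eq_abs, Real.abs_exp, ← Real.exp_add, Real.exp_le_exp]
  have := (abs_le.1 (hM y)).2
  linarith

theorem gaussInt_pos {g : ℝ → ℝ} (hg : Measurable g) {M : ℝ} (hM : ∀ x, |g x| ≤ M)
    {t : ℝ} (ht : 0 < t) : 0 < gaussInt g t :=
  integral_exp_pos (integrable_exp_sub_sq hg hM ht)

theorem tendsto_gaussInt {g : ℝ → ℝ} (hg : Measurable g) {M : ℝ} (hM : ∀ x, |g x| ≤ M) :
    Tendsto (gaussInt g) (nhds 1) (nhds (gaussInt g 1)) := by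
  refine tendsto_integral_filter_of_dominated_convergence
    (fun y => Real.exp (g y - 1 / 2 * y ^ 2 / 2)) (Eventually.of_forall fun t => by fun_prop) ?_
    (integrable_exp_sub_sq hg hM (by norm_num)) (Eventually.of_forall fun y => ?_)
  · filter_upwards [lt_mem_nhds (show (1 / 2 : ℝ) < 1 by norm_num)] with t ht
    refine Eventually.of_forall fun y => ?_
    rw [Real.norm_eq_abs, Real.abs_exp, Real.exp_le_exp]
    have := mul_le_mul_of_nonneg_right ht.le (sq_nonneg y)
    linarith
  · exact Continuous.tendsto (by fun_prop) 1

theorem lintegral_exp_scaled {g : ℝ → ℝ} (hg : Measurable g) {M : ℝ} (hM : ∀ x, |g x| ≤ M)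
    {t n : ℝ} (ht : 0 < t) (hn : 0 < n) :
    ∫⁻ z, ENNReal.ofReal (Real.exp (g (√n * z) - t * n * z ^ 2 / 2))
      = ENNReal.ofReal ((√n)⁻¹ * gaussInt g t) := by
  have hs := Real.sqrt_pos.2 hn
  have h : ∀ z, g (√n * z) - t * n * z ^ 2 / 2 = g (√n * z) - t * (√n * z) ^ 2 / 2 := fun z => by
    rw [mul_pow, Real.sq_sqrt hn.le]
    ring
  simp only [h]
  have hint := integrable_exp_sub_sq hg hM ht
  rw [← ofReal_integral_eq_lintegral_ofReal (hint.comp_mul_left' hs.ne')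
    (Eventually.of_forall fun _ => (Real.exp_pos _).le),
    Measure.integral_comp_mul_left (fun y => Real.exp (g y - t * y ^ 2 / 2)) √n, smul_eq_mul,
    abs_of_pos (inv_pos.2 hs)]
  rfl

/-- The integral of `exp (∑ g (√n z))` against the unnormalised density of an orthogonal corner. -/
noncomputable def cornerInt (g : ℝ → ℝ) (m k q : ℕ) (n : ℝ) : ℝ≥0∞ :=
  ∫⁻ Z : Fin k → Fin m → ℝ,
    ENNReal.ofReal (Real.exp (∑ j, ∑ i, g (√n * Z j i))) * ENNReal.ofReal (rootDet k Z ^ q)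

theorem cornerInt_le {g : ℝ → ℝ} (hg : Measurable g) {M : ℝ} (hM : ∀ x, |g x| ≤ M)
    (m k : ℕ) {q : ℕ} (hq : q ≠ 0) {n : ℝ} (hn : 0 < n) :
    cornerInt g m k q n ≤ ENNReal.ofReal (((√n)⁻¹ * gaussInt g (q / n)) ^ (m * k)) := by
  have hq0 : (0 : ℝ) < q := by positivity
  have ht : 0 < q / n := by positivity
  rw [ENNReal.ofReal_pow (mul_nonneg (by positivity) (gaussInt_pos hg hM ht).le),
    ← lintegral_exp_scaled hg hM ht hn, ← lintegral_exp_sum_sum (by fun_prop)]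
  refine lintegral_mono fun Z => ?_
  rw [← ENNReal.ofReal_mul (Real.exp_pos _).le]
  refine ENNReal.ofReal_le_ofReal ?_
  have h1 := pow_le_pow_left₀ (rootDet_nonneg k Z) (rootDet_le_exp k Z) q
  refine (mul_le_mul_of_nonneg_left h1 (Real.exp_pos _).le).trans_eq ?_
  rw [← Real.exp_nat_mul, ← Real.exp_add, div_mul_cancel₀ _ hn.ne']
  congr 1
  simp only [Finset.sum_sub_distrib, dotProduct, ← sq, ← Finset.sum_div, ← Finset.mul_sum]
  ring

theorem exp_neg_le_one_sub {S : ℝ} (h0 : 0 ≤ S) (h1 : S ≤ 1 / 2) :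
    Real.exp (-(S + S ^ 2)) ≤ 1 - S := by
  have h2 : 1 ≤ (1 - S) * (1 + (S + S ^ 2) + (S + S ^ 2) ^ 2 / 2) := by
    nlinarith [mul_nonneg h0 h0, mul_nonneg (mul_nonneg h0 h0) h0]
  have h3 : 1 + (S + S ^ 2) + (S + S ^ 2) ^ 2 / 2 ≤ Real.exp (S + S ^ 2) :=
    Real.quadratic_le_exp_of_nonneg (by positivity)
  rw [Real.exp_neg, inv_le_iff_one_le_mul₀ (Real.exp_pos _)]
  nlinarith

theorem exp_le_rootDet_pow {m k q : ℕ} {n b : ℝ} (hqn : q ≤ n) (hn : 0 < n) (hb : b / n ≤ 1 / 2)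
    (Z : Fin k → Fin m → ℝ) (hZ : n * ∑ j, Z j ⬝ᵥ Z j ≤ b) :
    Real.exp (-(n * ∑ j, Z j ⬝ᵥ Z j) / 2 - b ^ 2 / (2 * n)) ≤ rootDet k Z ^ q := by
  have hS : 0 ≤ ∑ j, Z j ⬝ᵥ Z j := Finset.sum_nonneg fun j _ => dotProduct_self_nonneg_real _
  have h1 := le_rootDet_sq k Z
  generalize ∑ j, Z j ⬝ᵥ Z j = S at *
  have hSb : S ≤ b / n := (le_div_iff₀' hn).2 hZ
  have h2 := (exp_neg_le_one_sub hS (hSb.trans hb)).trans h1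
  refine le_of_sq_le_sq ?_ (pow_nonneg (rootDet_nonneg k Z) q)
  rw [← pow_mul, mul_comm q 2, pow_mul]
  refine le_trans ?_ (pow_le_pow_left₀ (Real.exp_pos _).le h2 q)
  rw [← Real.exp_nat_mul, ← Real.exp_nat_mul, Real.exp_le_exp]
  have h3 : q * (S + S ^ 2) ≤ n * (S + S ^ 2) := mul_le_mul_of_nonneg_right hqn (by positivity)
  have h4 : n * S ^ 2 ≤ b ^ 2 / n := by
    rw [le_div_iff₀ hn]
    nlinarith [mul_nonneg hn.le hS]
  have h5 : b ^ 2 / (2 * n) = b ^ 2 / n / 2 := by field_simp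
  rw [h5]
  push_cast
  linarith

theorem le_cornerInt {g : ℝ → ℝ} (hg : Measurable g) {M : ℝ} (hM : ∀ x, |g x| ≤ M)
    {m k q : ℕ} {n K : ℝ} (hqn : q ≤ n) (hn : 0 < n) (hb : K * (m * k : ℕ) / n ≤ 1 / 2)
    (hp : m * k ≠ 0) (hK : Real.exp (-K / 4) * gaussInt g (1 / 2) ≤ gaussInt g 1 / 2) :
    ENNReal.ofReal (((√n)⁻¹ * gaussInt g 1) ^ (m * k) / 2
      * Real.exp (-(K * (m * k : ℕ)) ^ 2 / (2 * n))) ≤ cornerInt g m k q n := by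
  have hs := Real.sqrt_pos.2 hn
  set p := m * k with hpdef
  set b := K * (p : ℝ) with hbdef
  set E := b ^ 2 / (2 * n) with hE
  have ha1 := gaussInt_pos hg hM one_pos
  have ha2 := gaussInt_pos hg hM (one_half_pos (α := ℝ))
  have hB : ENNReal.ofReal (((√n)⁻¹ * gaussInt g 1) ^ p)
      = ∫⁻ Z : Fin k → Fin m → ℝ, ENNReal.ofReal (Real.exp (∑ j, ∑ i,
        (g (√n * Z j i) - 1 * n * Z j i ^ 2 / 2))) := by
    rw [lintegral_exp_sum_sum (h := fun z => g (√n * z) - 1 * n * z ^ 2 / 2) (by fun_prop),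
      lintegral_exp_scaled hg hM one_pos hn, ENNReal.ofReal_pow (by positivity)]
  have hW : ENNReal.ofReal (Real.exp (-b / 4) * ((√n)⁻¹ * gaussInt g (1 / 2)) ^ p)
      = ENNReal.ofReal (Real.exp (-b / 4)) * ∫⁻ Z : Fin k → Fin m → ℝ,
        ENNReal.ofReal (Real.exp (∑ j, ∑ i, (g (√n * Z j i) - 1 / 2 * n * Z j i ^ 2 / 2))) := by
    rw [lintegral_exp_sum_sum (h := fun z => g (√n * z) - 1 / 2 * n * z ^ 2 / 2) (by fun_prop),
      lintegral_exp_scaled hg hM one_half_pos hn, ← ENNReal.ofReal_pow (by positivity),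
      ENNReal.ofReal_mul (by positivity)]
  have hle : ENNReal.ofReal (((√n)⁻¹ * gaussInt g 1) ^ p)
      ≤ ENNReal.ofReal (Real.exp E) * cornerInt g m k q n
        + ENNReal.ofReal (Real.exp (-b / 4) * ((√n)⁻¹ * gaussInt g (1 / 2)) ^ p) := by
    rw [hB, hW, cornerInt, ← lintegral_const_mul' _ _ ENNReal.ofReal_ne_top,
      ← lintegral_const_mul' _ _ ENNReal.ofReal_ne_top, ← lintegral_add_right _ (by fun_prop)]
    refine lintegral_mono fun Z => ?_
    simp only [← ENNReal.ofReal_mul (Real.exp_pos _).le]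
    rw [← ENNReal.ofReal_add (by have := pow_nonneg (rootDet_nonneg k Z) q; positivity)
      (by positivity)]
    refine ENNReal.ofReal_le_ofReal ?_
    have hsum : ∀ t : ℝ, ∑ j, ∑ i, (g (√n * Z j i) - t * n * Z j i ^ 2 / 2)
        = ∑ j, ∑ i, g (√n * Z j i) - t * (n * ∑ j, Z j ⬝ᵥ Z j) / 2 := fun t => by
      simp only [Finset.sum_sub_distrib, dotProduct, ← sq, ← Finset.sum_div, ← Finset.mul_sum]
      ring
    rw [hsum, hsum]
    generalize ∑ j, ∑ i, g (√n * Z j i) = F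
    rcases le_or_gt (n * ∑ j, Z j ⬝ᵥ Z j) b with hZ | hZ
    · refine le_add_of_le_of_nonneg ?_ (by positivity)
      have h1 := exp_le_rootDet_pow hqn hn hb Z hZ
      refine le_trans (le_of_eq ?_) (mul_le_mul_of_nonneg_left
        (mul_le_mul_of_nonneg_left h1 (Real.exp_pos F).le) (Real.exp_pos E).le)
      rw [← Real.exp_add, ← Real.exp_add]
      congr 1
      ring
    · refine le_add_of_nonneg_of_le
        (by have := pow_nonneg (rootDet_nonneg k Z) q; positivity) ?_
      rw [← Real.exp_add, Real.exp_le_exp]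
      linarith
  have hsmall : Real.exp (-b / 4) * ((√n)⁻¹ * gaussInt g (1 / 2)) ^ p
      ≤ ((√n)⁻¹ * gaussInt g 1) ^ p / 2 := by
    have h1 : Real.exp (-b / 4) = Real.exp (-K / 4) ^ p := by
      rw [← Real.exp_nat_mul]
      congr 1
      rw [hbdef]
      ring
    have h2 : Real.exp (-K / 4) * ((√n)⁻¹ * gaussInt g (1 / 2)) ≤ (√n)⁻¹ * gaussInt g 1 / 2 := by
      have := mul_le_mul_of_nonneg_left hK (inv_pos.2 hs).le
      linarith
    rw [h1, ← mul_pow]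
    refine (pow_le_pow_left₀ (by positivity) h2 p).trans ?_
    rw [div_pow]
    refine div_le_div_of_nonneg_left (by positivity) two_pos ?_
    exact le_self_pow₀ one_le_two hp
  have hpos : 0 ≤ ((√n)⁻¹ * gaussInt g 1) ^ p / 2 := by positivity
  have h1 : ENNReal.ofReal (((√n)⁻¹ * gaussInt g 1) ^ p / 2)
      ≤ ENNReal.ofReal (Real.exp E) * cornerInt g m k q n := by
    have h2 := hle.trans (add_le_add_right (ENNReal.ofReal_le_ofReal hsmall) _)
    nth_rewrite 1 [← add_halves (((√n)⁻¹ * gaussInt g 1) ^ p)] at h2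
    rw [ENNReal.ofReal_add hpos hpos] at h2
    exact (ENNReal.add_le_add_iff_right ENNReal.ofReal_ne_top).1 h2
  have hE' : -b ^ 2 / (2 * n) = -E := by rw [hE]; ring
  rw [hE', mul_comm, ENNReal.ofReal_mul (Real.exp_pos _).le]
  refine (mul_le_mul_right h1 _).trans_eq ?_
  rw [← mul_assoc, ← ENNReal.ofReal_mul (Real.exp_pos _).le, ← Real.exp_add, neg_add_cancel,
    Real.exp_zero, ENNReal.ofReal_one, one_mul]

/-- The moment generating functional of the rescaled top left corner. -/
noncomputable def cornerMGF {N : ℕ} (μ : Measure (Matrix (Fin N) (Fin N) ℝ)) (g : ℝ → ℝ)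
    (m k : ℕ) : ℝ :=
  ∫ A, Real.exp (∑ i ∈ Finset.range m, ∑ j ∈ Finset.range k, g (√N * entryOrZero A i j)) ∂μ

theorem ofReal_cornerMGF {N : ℕ} {μ : Measure (Matrix (Fin N) (Fin N) ℝ)}
    (hμ : IsOrthogonalHaar μ) {g : ℝ → ℝ} (hg : Measurable g) {M : ℝ} (hM : ∀ x, |g x| ≤ M)
    (m k : ℕ) : ENNReal.ofReal (cornerMGF μ g m k)
      = ∫⁻ A, ENNReal.ofReal (Real.exp (∑ j, ∑ i, g (√N * corner m k A j i))) ∂μ := by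
  have := hμ.prob
  have hsum : ∀ A : Matrix (Fin N) (Fin N) ℝ,
      ∑ i ∈ Finset.range m, ∑ j ∈ Finset.range k, g (√N * entryOrZero A i j)
        = ∑ j, ∑ i, g (√N * corner m k A j i) := fun A => by
    simp only [Finset.sum_range]
    exact Finset.sum_comm
  have hmeas : Measurable fun A : Matrix (Fin N) (Fin N) ℝ =>
      Real.exp (∑ j, ∑ i, g (√N * corner m k A j i)) :=
    (show Measurable fun Z : Fin k → Fin m → ℝ => Real.exp (∑ j, ∑ i, g (√N * Z j i)) by
      fun_prop).comp (measurable_corner m k N)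
  simp only [cornerMGF, hsum]
  refine ofReal_integral_eq_lintegral_ofReal (Integrable.of_bound hmeas.aestronglyMeasurable
    (Real.exp (∑ _j : Fin k, ∑ _i : Fin m, M)) (Eventually.of_forall fun A => ?_))
    (Eventually.of_forall fun _ => (Real.exp_pos _).le)
  rw [Real.norm_eq_abs, Real.abs_exp, Real.exp_le_exp]
  exact Finset.sum_le_sum fun j _ => Finset.sum_le_sum fun i _ => (abs_le.1 (hM _)).2

theorem ofReal_cornerMGF_mul_cornerInt {μ : ∀ N, Measure (Matrix (Fin N) (Fin N) ℝ)}
    (hμ : ∀ N, IsOrthogonalHaar (μ N)) {m k q N : ℕ} (hq : q ≠ 0) (hN : N = q + m + k + 1)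
    {g : ℝ → ℝ} (hg : Measurable g) {M : ℝ} (hM : ∀ x, |g x| ≤ M) :
    ENNReal.ofReal (cornerMGF (μ N) g m k) * cornerInt 0 m k q N = cornerInt g m k q N := by
  obtain ⟨c, hc⟩ := exists_lintegral_corner hμ hq m k
  rw [← hN] at hc
  have h : ∀ g : ℝ → ℝ, Measurable g →
      ∫⁻ A, ENNReal.ofReal (Real.exp (∑ j, ∑ i, g (√N * corner m k A j i))) ∂(μ N)
        = c * cornerInt g m k q N := fun g hg =>
    hc (fun Z => ENNReal.ofReal (Real.exp (∑ j, ∑ i, g (√N * Z j i)))) (by fun_prop)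
  have h0 := h 0 measurable_zero
  have := (hμ N).prob
  simp only [Pi.zero_apply, Finset.sum_const_zero, Real.exp_zero, ENNReal.ofReal_one,
    lintegral_const, measure_univ, mul_one] at h0
  rw [ofReal_cornerMGF (hμ N) hg hM, h g hg, mul_right_comm, ← h0, one_mul]

theorem exists_exp_mul_le {a W : ℝ} (ha : 0 < a) (hW : 0 < W) :
    ∃ K, Real.exp (-K / 4) * W ≤ a / 2 := by
  refine ⟨-4 * Real.log (a / 2 / W), ?_⟩
  rw [show -(-4 * Real.log (a / 2 / W)) / 4 = Real.log (a / 2 / W) by ring,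
    Real.exp_log (by positivity), div_mul_cancel₀ _ hW.ne']

theorem log_half_mul_exp {x E : ℝ} (hx : 0 < x) (p : ℕ) :
    Real.log (x ^ p / 2 * Real.exp E) = p * Real.log x - Real.log 2 + E := by
  rw [Real.log_mul (by positivity) (Real.exp_pos _).ne', Real.log_exp,
    Real.log_div (by positivity) two_ne_zero, Real.log_pow]

theorem le_inv_mul_log {e a b s E : ℝ} {p : ℕ} (hp : p ≠ 0) (hs : 0 < s) (ha : 0 < a) (hb : 0 < b)
    (he : 0 < e) (h : (s * a) ^ p / 2 * Real.exp (-E) ≤ e * (s * b) ^ p) :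
    Real.log a - Real.log b - (Real.log 2 + E) / p ≤ (p : ℝ)⁻¹ * Real.log e := by
  have h1 := Real.log_le_log (by positivity) h
  rw [log_half_mul_exp (by positivity), Real.log_mul he.ne' (by positivity), Real.log_pow,
    Real.log_mul hs.ne' ha.ne', Real.log_mul hs.ne' hb.ne'] at h1
  have hp0 : (0 : ℝ) < p := by positivity
  rw [← div_eq_inv_mul, le_div_iff₀ hp0, sub_mul, div_mul_cancel₀ _ hp0.ne']
  linarith

theorem inv_mul_log_le {e a b s E : ℝ} {p : ℕ} (hp : p ≠ 0) (hs : 0 < s) (ha : 0 < a) (hb : 0 < b)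
    (he : 0 < e) (h : e * ((s * b) ^ p / 2 * Real.exp (-E)) ≤ (s * a) ^ p) :
    (p : ℝ)⁻¹ * Real.log e ≤ Real.log a - Real.log b + (Real.log 2 + E) / p := by
  have h1 := Real.log_le_log (by positivity) h
  rw [Real.log_mul he.ne' (by positivity), log_half_mul_exp (by positivity), Real.log_pow,
    Real.log_mul hs.ne' ha.ne', Real.log_mul hs.ne' hb.ne'] at h1
  have hp0 : (0 : ℝ) < p := by positivity
  rw [← div_eq_inv_mul, div_le_iff₀ hp0, add_mul, div_mul_cancel₀ _ hp0.ne']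
  linarith

theorem log_integral_exp_gaussianReal {g : ℝ → ℝ} (hg : Measurable g) {M : ℝ}
    (hM : ∀ x, |g x| ≤ M) :
    Real.log (∫ x, Real.exp (g x) ∂(gaussianReal 0 1))
      = Real.log (gaussInt g 1) - Real.log (gaussInt 0 1) := by
  have h : ∀ g : ℝ → ℝ, ∫ x, Real.exp (g x) ∂(gaussianReal 0 1)
      = (√(2 * Real.pi))⁻¹ * gaussInt g 1 := fun g => by
    rw [integral_gaussianReal_eq_integral_smul one_ne_zero, gaussInt, ← integral_const_mul]
    refine integral_congr_ae (Eventually.of_forall fun x => ?_)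
    simp only [gaussianPDFReal, smul_eq_mul, NNReal.coe_one, mul_one, sub_zero, one_mul, mul_assoc,
      ← Real.exp_add]
    congr 2
    ring
  have h0 := h 0
  simp only [Pi.zero_apply, Real.exp_zero, integral_const, probReal_univ, smul_eq_mul,
    mul_one] at h0
  have hpi : (0 : ℝ) < (√(2 * Real.pi))⁻¹ := by positivity
  have h0' := congrArg Real.log h0
  rw [Real.log_one, Real.log_mul hpi.ne'
    (gaussInt_pos measurable_zero (M := 0) (by simp) one_pos).ne'] at h0'
  rw [h, Real.log_mul hpi.ne' (gaussInt_pos hg hM one_pos).ne']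
  linarith

/-- Finite-size bounds for the normalized logarithmic moment generating functional. -/
theorem inv_mul_log_cornerMGF_bounds {μ : ∀ N, Measure (Matrix (Fin N) (Fin N) ℝ)}
    (hμ : ∀ N, IsOrthogonalHaar (μ N)) {m k q N : ℕ} (hq : q ≠ 0) (hN : N = q + m + k + 1)
    {g : ℝ → ℝ} (hg : Measurable g) {M : ℝ} (hM : ∀ x, |g x| ≤ M) (hp : m * k ≠ 0) {K K₀ : ℝ}
    (hK : Real.exp (-K / 4) * gaussInt g (1 / 2) ≤ gaussInt g 1 / 2)
    (hK₀ : Real.exp (-K₀ / 4) * gaussInt 0 (1 / 2) ≤ gaussInt 0 1 / 2)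
    (hb : K * (m * k : ℕ) / N ≤ 1 / 2) (hb₀ : K₀ * (m * k : ℕ) / N ≤ 1 / 2) :
    Real.log (gaussInt g 1) - Real.log (gaussInt 0 (q / N))
        - (Real.log 2 + (K * (m * k : ℕ)) ^ 2 / (2 * N)) / (m * k : ℕ)
      ≤ ((m * k : ℕ) : ℝ)⁻¹ * Real.log (cornerMGF (μ N) g m k) ∧
    ((m * k : ℕ) : ℝ)⁻¹ * Real.log (cornerMGF (μ N) g m k)
      ≤ Real.log (gaussInt g (q / N)) - Real.log (gaussInt 0 1)
        + (Real.log 2 + (K₀ * (m * k : ℕ)) ^ 2 / (2 * N)) / (m * k : ℕ) := by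
  have hN0 : (0 : ℝ) < N := by
    rw [hN]
    positivity
  have hqN : (q : ℝ) ≤ N := by
    rw [hN]
    exact_mod_cast (by omega)
  have hM0 : ∀ x, |(0 : ℝ → ℝ) x| ≤ (0 : ℝ) := by simp
  have hq0 : (0 : ℝ) < q / N := by positivity
  have hs : 0 < (√(N : ℝ))⁻¹ := by positivity
  have hg1 := gaussInt_pos hg hM one_pos
  have hgq := gaussInt_pos hg hM hq0
  have h01 := gaussInt_pos measurable_zero hM0 one_pos
  have h0q := gaussInt_pos measurable_zero hM0 hq0
  have hmain := ofReal_cornerMGF_mul_cornerInt hμ hq hN hg hM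
  have he0 : 0 ≤ cornerMGF (μ N) g m k := integral_nonneg fun _ => (Real.exp_pos _).le
  have hlow := (le_cornerInt hg hM hqN hN0 hb hp hK).trans_eq hmain.symm
  have hlow' := hlow.trans (mul_le_mul_right (cornerInt_le measurable_zero hM0 m k hq hN0) _)
  rw [← ENNReal.ofReal_mul he0, ENNReal.ofReal_le_ofReal_iff (by positivity), neg_div] at hlow'
  have hupp := hmain.trans_le (cornerInt_le hg hM m k hq hN0)
  have hupp' := (mul_le_mul_right (le_cornerInt measurable_zero hM0 hqN hN0 hb₀ hp hK₀)
    (ENNReal.ofReal (cornerMGF (μ N) g m k))).trans hupp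
  rw [← ENNReal.ofReal_mul he0, ENNReal.ofReal_le_ofReal_iff (by positivity), neg_div] at hupp'
  have he : 0 < cornerMGF (μ N) g m k := by
    refine pos_of_mul_pos_left (lt_of_lt_of_le ?_ hlow') (by positivity)
    positivity
  exact ⟨le_inv_mul_log hp hs hg1 h0q he hlow', inv_mul_log_le hp hs hgq h01 he hupp'⟩

/-- **Limit of the normalized logarithmic moment generating functional.** Here `μ N` is
the Haar probability measure on `O(N)`, viewed as a measure on `N × N` matrices, and
`y_{i,j}^{(N)} = √N · (A_N)_{i,j}`. For every bounded measurable `f : ℝ → ℝ`,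
`(1/p_N) log 𝔼[exp(∑_{i,j} f(y_{i,j}^{(N)}))] → log ∫ e^{f} dγ`. -/
theorem stmt_7
    (m k : ℕ → ℕ)
    (hp_top : Tendsto (fun N => m N * k N) atTop atTop)
    (hp_o : (fun N => (m N * k N : ℝ)) =o[atTop] fun N => (N : ℝ))
    (μ : (N : ℕ) → Measure (Matrix (Fin N) (Fin N) ℝ))
    (hμ_prob : ∀ N, IsProbabilityMeasure (μ N))
    (hμ_supp : ∀ N, μ N {A | A * Aᵀ = 1} = 1)
    (hμ_inv : ∀ N (B : Matrix (Fin N) (Fin N) ℝ), B * Bᵀ = 1 →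
      (μ N).map (fun A => B * A) = μ N)
    (f : ℝ → ℝ) (hf_meas : Measurable f) (hf_bdd : ∃ M, ∀ x, |f x| ≤ M) :
    Tendsto
      (fun N => ((m N * k N : ℝ))⁻¹ *
        Real.log (∫ A, Real.exp (∑ i ∈ Finset.range (m N), ∑ j ∈ Finset.range (k N),
          f (Real.sqrt N * entryOrZero A i j)) ∂(μ N)))
      atTop (nhds (Real.log (∫ x, Real.exp (f x) ∂(gaussianReal 0 1)))) := by
  obtain ⟨M, hM⟩ := hf_bdd
  have hμ : ∀ N, IsOrthogonalHaar (μ N) := fun N => ⟨hμ_prob N, hμ_supp N, hμ_inv N⟩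
  have hM0 : ∀ x, |(0 : ℝ → ℝ) x| ≤ (0 : ℝ) := by simp
  have h01 := gaussInt_pos measurable_zero hM0 one_pos
  have hf1 := gaussInt_pos hf_meas hM one_pos
  obtain ⟨K, hK⟩ := exists_exp_mul_le hf1 (gaussInt_pos hf_meas hM one_half_pos)
  obtain ⟨K₀, hK₀⟩ := exists_exp_mul_le h01 (gaussInt_pos measurable_zero hM0 one_half_pos)
  have hpN : Tendsto (fun N => ((m N * k N : ℕ) : ℝ) / N) atTop (nhds 0) := by
    simpa using hp_o.tendsto_div_nhds_zero
  have hp_real : Tendsto (fun N => ((m N * k N : ℕ) : ℝ)) atTop atTop :=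
    tendsto_natCast_atTop_atTop.comp hp_top
  have hN_inv : Tendsto (fun N : ℕ => ((N : ℝ))⁻¹) atTop (nhds 0) :=
    tendsto_inv_atTop_zero.comp tendsto_natCast_atTop_atTop
  have hsmall : Tendsto (fun N => ((m N * k N : ℕ) : ℝ) / N + 2 * (N : ℝ)⁻¹) atTop (nhds 0) := by
    simpa using hpN.add (hN_inv.const_mul 2)
  have hsize : ∀ᶠ N in atTop, 0 < N ∧ m N * k N ≠ 0 ∧ m N + k N ≤ m N * k N + 1 ∧
      m N * k N + 2 < N := by
    filter_upwards [hp_top.eventually_gt_atTop 0, eventually_gt_atTop 0,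
      hsmall.eventually_lt_const one_pos] with N hp hN h1
    refine ⟨hN, hp.ne', ?_, ?_⟩
    · have hm : 0 < m N := Nat.pos_of_mul_pos_right hp
      have hk : 0 < k N := Nat.pos_of_mul_pos_left hp
      nlinarith
    · have hN' : (0 : ℝ) < N := by exact_mod_cast hN
      rw [← div_eq_mul_inv, ← add_div, div_lt_one hN'] at h1
      exact_mod_cast h1
  let q : ℕ → ℕ := fun N => N - (m N + k N + 1)
  have hqN : Tendsto (fun N => (q N : ℝ) / N) atTop (nhds 1) := by
    refine tendsto_of_tendsto_of_tendsto_of_le_of_le' (by simpa using hsmall.const_sub 1)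
      tendsto_const_nhds ?_ (Eventually.of_forall fun N =>
        div_le_one_of_le₀ (by exact_mod_cast Nat.sub_le _ _) N.cast_nonneg)
    filter_upwards [hsize] with N ⟨hN, _, h2, h3⟩
    have hN' : (0 : ℝ) < N := by exact_mod_cast hN
    have h4 : N ≤ q N + (m N * k N + 2) := by
      simp only [q]
      omega
    have h5 : (N : ℝ) ≤ q N + ((m N * k N : ℕ) + 2) := by exact_mod_cast h4
    push_cast at h5
    rw [← div_eq_mul_inv, ← add_div, le_div_iff₀ hN', sub_mul, div_mul_cancel₀ _ hN'.ne']
    linarith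
  have herr : ∀ K : ℝ, Tendsto (fun N => (Real.log 2 + (K * (m N * k N : ℕ)) ^ 2 / (2 * N))
      / (m N * k N : ℕ)) atTop (nhds 0) := fun K => by
    have h := (hp_real.const_div_atTop (Real.log 2)).add (hpN.const_mul (K ^ 2 / 2))
    rw [mul_zero, add_zero] at h
    refine h.congr' ?_
    filter_upwards [hsize] with N ⟨hN, hp, _, _⟩
    have hN' : (N : ℝ) ≠ 0 := by exact_mod_cast hN.ne'
    have hp' : ((m N * k N : ℕ) : ℝ) ≠ 0 := by exact_mod_cast hp
    field_simp
  have hlog0 : Tendsto (fun N => Real.log (gaussInt 0 (q N / N))) atTop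
      (nhds (Real.log (gaussInt 0 1))) :=
    ((tendsto_gaussInt measurable_zero hM0).comp hqN).log h01.ne'
  have hlogf : Tendsto (fun N => Real.log (gaussInt f (q N / N))) atTop
      (nhds (Real.log (gaussInt f 1))) :=
    ((tendsto_gaussInt hf_meas hM).comp hqN).log hf1.ne'
  have hKsmall : ∀ K : ℝ, ∀ᶠ N in atTop, K * (m N * k N : ℕ) / N ≤ 1 / 2 := fun K => by
    have h := hpN.const_mul K
    rw [mul_zero] at h
    filter_upwards [h.eventually_le_const one_half_pos] with N hN
    rwa [mul_div_assoc]
  have hbounds : ∀ᶠ N in atTop,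
      Real.log (gaussInt f 1) - Real.log (gaussInt 0 (q N / N))
          - (Real.log 2 + (K * (m N * k N : ℕ)) ^ 2 / (2 * N)) / (m N * k N : ℕ)
        ≤ ((m N * k N : ℕ) : ℝ)⁻¹ * Real.log (cornerMGF (μ N) f (m N) (k N)) ∧
      ((m N * k N : ℕ) : ℝ)⁻¹ * Real.log (cornerMGF (μ N) f (m N) (k N))
        ≤ Real.log (gaussInt f (q N / N)) - Real.log (gaussInt 0 1)
          + (Real.log 2 + (K₀ * (m N * k N : ℕ)) ^ 2 / (2 * N)) / (m N * k N : ℕ) := by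
    filter_upwards [hsize, hKsmall K, hKsmall K₀] with N ⟨hN, hp, h2, h3⟩ hb hb₀
    exact inv_mul_log_cornerMGF_bounds hμ (m := m N) (k := k N) (q := q N) (N := N)
      (by simp only [q]; omega) (by simp only [q]; omega) hf_meas hM hp hK hK₀ hb hb₀
  rw [log_integral_exp_gaussianReal hf_meas hM]
  have hlow := (hlog0.const_sub (Real.log (gaussInt f 1))).sub (herr K)
  have hupp := (hlogf.sub_const (Real.log (gaussInt 0 1))).add (herr K₀)
  rw [sub_zero] at hlow
  rw [add_zero] at hupp
  have := tendsto_of_tendsto_of_tendsto_of_le_of_le' hlow hupp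
    (hbounds.mono fun N h => h.1) (hbounds.mono fun N h => h.2)
  simpa only [cornerMGF, Nat.cast_mul] using this
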